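/- arXiv:1201.4319 — 5 statements merged into one kernel-verified Lean document; each statement's English description precedes it below -/
import Mathlib

section
/- Let σ and w be locally finite positive Borel measures on ℝ with no common point masses satisfying the Poisson A₂ condition P(σ,I)·P(w,I) ≤ 𝒜₂ < ∞ for all intervals I. Let 𝒩_hard = sup_{0<ε<δ} ‖f ↦ H^{hard}_{ε,δ}(fσ)‖_{L²(σ)→L²(w)} and 𝒩_smooth = sup_{0<α<β} ‖f ↦ H_{α,β}(fσ)‖_{L²(σ)→L²(w)}. Then 𝒩_hard ≤ 𝒩_smooth + C·𝒜₂^{1/2} and 𝒩_smooth ≤ 𝒩_hard + C·𝒜₂^{1/2} for an absolute constant C; in particular 𝒩_hard is finite if and only if 𝒩_smooth is finite. -/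
open MeasureTheory Set Metric Filter
open scoped ENNReal NNReal

noncomputable section

namespace TwoWeight

/-! ### Truncated Hilbert transforms -/

/-- The smooth truncation kernel `K_{α,β}` on the positive half-line. -/
def K0 (α β y : ℝ) : ℝ :=
  if y < α then -y / α ^ 2 + 2 / α
  else if y ≤ β then 1 / y
  else if y < 2 * β then -y / β ^ 2 + 2 / β
  else 0

/-- The smooth truncation kernel `K_{α,β}`: odd, vanishing at `0`. -/
def Kab (α β y : ℝ) : ℝ :=
  if 0 < y then K0 α β y else if y < 0 then -K0 α β (-y) else 0

/-- Smoothly truncated Hilbert transform `H_{α,β}(fσ)(x) = ∫ K_{α,β}(y-x) f(y) dσ(y)`. -/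
def Hsm (σ : Measure ℝ) (f : ℝ → ℝ) (α β x : ℝ) : ℝ :=
  ∫ y, Kab α β (y - x) * f y ∂σ

/-- Smoothly truncated Hilbert transform of the measure `1_s σ`. -/
def HsmS (σ : Measure ℝ) (s : Set ℝ) (α β x : ℝ) : ℝ :=
  ∫ y in s, Kab α β (y - x) ∂σ

/-- Hard truncated Hilbert transform `H_{ε,δ}(fσ)(x) = ∫_{ε<|y-x|<δ} f(y)/(y-x) dσ(y)`. -/
def Hhard (σ : Measure ℝ) (f : ℝ → ℝ) (ε δ x : ℝ) : ℝ :=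
  ∫ y in {y : ℝ | ε < |y - x| ∧ |y - x| < δ}, f y / (y - x) ∂σ

/-- Hard truncated Hilbert transform of the measure `1_s σ`. -/
def HhardS (σ : Measure ℝ) (s : Set ℝ) (ε δ x : ℝ) : ℝ :=
  ∫ y in s ∩ {y : ℝ | ε < |y - x| ∧ |y - x| < δ}, 1 / (y - x) ∂σ

/-! ### Poisson averages and extensions -/

/-- Poisson average `P(σ, I)` of a measure relative to a set `s` of "length" `len`. -/
def Pois (σ : Measure ℝ) (s : Set ℝ) (len : ℝ) : ℝ≥0∞ :=
  ∫⁻ x, ENNReal.ofReal (len / (len ^ 2 + infDist x s ^ 2)) ∂σ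

/-- Poisson extension `ℙν(x,t) = ∫ t/(t² + |x-y|²) dν(y)` to the upper half plane. -/
def PoisExt (ν : Measure ℝ) (x t : ℝ) : ℝ≥0∞ :=
  ∫⁻ y, ENNReal.ofReal (t / (t ^ 2 + (x - y) ^ 2)) ∂ν

/-- The Poisson `A₂` condition: `P(σ,I)·P(w,I) ≤ A₂` over all (open) intervals. -/
def A2cond (σ w : Measure ℝ) (A2 : ℝ) : Prop :=
  ∀ a b : ℝ, a < b →
    Pois σ (Ioo a b) (b - a) * Pois w (Ioo a b) (b - a) ≤ ENNReal.ofReal A2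

/-- The pair of weights has no common point masses. -/
def NoCommonMass (σ w : Measure ℝ) : Prop := ∀ x : ℝ, σ {x} = 0 ∨ w {x} = 0

/-- `∫ f² dσ` as an extended real. -/
def sqInt (σ : Measure ℝ) (f : ℝ → ℝ) : ℝ≥0∞ :=
  ∫⁻ x, ENNReal.ofReal (f x ^ 2) ∂σ

/-- Interval testing conditions for the smooth truncations, with constant `T`:
`∫_I |H_{α,β}(1_I σ)|² dw ≤ T² σ(I)` and dually, over all intervals and truncations. -/
def TestingSm (σ w : Measure ℝ) (T : ℝ) : Prop :=
  ∀ a b α β : ℝ, a < b → 0 < α → α < β →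
    (∫⁻ x in Ioo a b, ENNReal.ofReal (HsmS σ (Ioo a b) α β x ^ 2) ∂w)
        ≤ ENNReal.ofReal (T ^ 2) * σ (Ioo a b) ∧
    (∫⁻ x in Ioo a b, ENNReal.ofReal (HsmS w (Ioo a b) α β x ^ 2) ∂σ)
        ≤ ENNReal.ofReal (T ^ 2) * w (Ioo a b)

/-! ### The standard dyadic grid.  A dyadic interval `[2^k m, 2^k (m+1))` is coded by
the pair `(k, m) : ℤ × ℤ`. -/

/-- Length `2^k` of the dyadic interval coded by `(k,m)`. -/
def dlen (I : ℤ × ℤ) : ℝ := (2 : ℝ) ^ I.1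

/-- Left endpoint of a dyadic interval. -/
def dleft (I : ℤ × ℤ) : ℝ := (2 : ℝ) ^ I.1 * I.2

/-- Right endpoint of a dyadic interval. -/
def dright (I : ℤ × ℤ) : ℝ := (2 : ℝ) ^ I.1 * (I.2 + 1)

/-- Center of a dyadic interval. -/
def dmid (I : ℤ × ℤ) : ℝ := dleft I + dlen I / 2

/-- The dyadic interval `[2^k m, 2^k (m+1)) ⊆ ℝ` coded by `(k,m)`. -/
def dset (I : ℤ × ℤ) : Set ℝ := Ico (dleft I) (dright I)

/-- Left child of a dyadic interval. -/
def childL (I : ℤ × ℤ) : ℤ × ℤ := (I.1 - 1, 2 * I.2)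

/-- Right child of a dyadic interval. -/
def childR (I : ℤ × ℤ) : ℤ × ℤ := (I.1 - 1, 2 * I.2 + 1)

/-- The child of `I` containing (the dyadic interval) `F`, defaulting to the left child. -/
def childC (I F : ℤ × ℤ) : ℤ × ℤ :=
  haveI := Classical.propDecidable (dset F ⊆ dset (childL I))
  if dset F ⊆ dset (childL I) then childL I else childR I

/-- `J ⋐ I` : `J ⊆ I` and `2^r |J| ≤ |I|`. -/
def cSub (r : ℕ) (J I : ℤ × ℤ) : Prop := dset J ⊆ dset I ∧ (2 : ℝ) ^ r * dlen J ≤ dlen I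

/-- A dyadic interval `J` is `(ε,r)`-good: for every dyadic `I` with `|I| ≥ 2^(r-1)|J|`,
the distance of `J` to each endpoint of each child of `I` is at least `|J|^ε |I|^(1-ε)`. -/
def IsGood (ε : ℝ) (r : ℕ) (J : ℤ × ℤ) : Prop :=
  ∀ I : ℤ × ℤ, (2 : ℝ) ^ ((r : ℤ) - 1) * dlen J ≤ dlen I →
    ∀ e ∈ ({dleft I, dmid I, dright I} : Set ℝ),
      dlen J ^ ε * dlen I ^ (1 - ε) ≤ infDist e (dset J)

/-! ### Haar functions and projections -/

/-- The `w`-Haar function associated to the dyadic interval `I`. -/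
def haar (w : Measure ℝ) (I : ℤ × ℤ) (x : ℝ) : ℝ :=
  Real.sqrt ((w (dset (childL I))).toReal * (w (dset (childR I))).toReal / (w (dset I)).toReal) *
    (-(dset (childL I)).indicator (fun _ => (1 : ℝ)) x / (w (dset (childL I))).toReal +
      (dset (childR I)).indicator (fun _ => (1 : ℝ)) x / (w (dset (childR I))).toReal)

/-- Haar coefficient `ĝ(I) = ⟨g, h^w_I⟩_{L²(w)}`. -/
def hcoef (w : Measure ℝ) (I : ℤ × ℤ) (g : ℝ → ℝ) : ℝ := ∫ x, g x * haar w I x ∂w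

/-- Haar martingale difference `Δ^w_I g = ĝ(I) h^w_I`. -/
def haarProj (w : Measure ℝ) (I : ℤ × ℤ) (g : ℝ → ℝ) (x : ℝ) : ℝ := hcoef w I g * haar w I x

/-- `σ`-average `E^σ_s f = σ(s)⁻¹ ∫_s f dσ`. -/
def avg (σ : Measure ℝ) (s : Set ℝ) (f : ℝ → ℝ) : ℝ := (∫ x in s, f x ∂σ) / (σ s).toReal

/-- The energy `E(w,I)² = w(I)⁻² ∬_{I×I} ((x-x')/|I|)² dw(x) dw(x')`. -/
def energySq (w : Measure ℝ) (I : ℤ × ℤ) : ℝ≥0∞ :=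
  (w (dset I))⁻¹ ^ 2 *
    ∫⁻ x in dset I, ∫⁻ y in dset I, ENNReal.ofReal (((x - y) / dlen I) ^ 2) ∂w ∂w

/-- `𝓕` is a `σ`-Carleson collection (with constant 2). -/
def Carleson (σ : Measure ℝ) (𝓕 : Set (ℤ × ℤ)) : Prop :=
  ∀ S : ℤ × ℤ, ∑' F : {F // F ∈ 𝓕 ∧ dset F ⊆ dset S}, σ (dset F.1) ≤ 2 * σ (dset S)

/-- `F = π_𝓕 J` : `F` is the minimal member of `𝓕` containing `J`. -/
def IsMinCont (𝓕 : Set (ℤ × ℤ)) (J F : ℤ × ℤ) : Prop :=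
  F ∈ 𝓕 ∧ dset J ⊆ dset F ∧ ∀ F' ∈ 𝓕, dset J ⊆ dset F' → dset F ⊆ dset F'

/-- `F` is the minimal member of `𝓕` strictly containing `J`. -/
def IsMinSCont (𝓕 : Set (ℤ × ℤ)) (J F : ℤ × ℤ) : Prop :=
  F ∈ 𝓕 ∧ dset J ⊂ dset F ∧ ∀ F' ∈ 𝓕, dset J ⊂ dset F' → dset F ⊆ dset F'

/-- `PiIter 𝓕 s J F` : `F = π^s_𝓕 J`, the `s`-fold iterate of the stopping parent of `J`. -/
def PiIter (𝓕 : Set (ℤ × ℤ)) : ℕ → ℤ × ℤ → ℤ × ℤ → Prop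
  | 0, J, F => J = F
  | 1, J, F => IsMinCont 𝓕 J F
  | n + 2, J, F => ∃ F', PiIter 𝓕 (n + 1) J F' ∧ IsMinSCont 𝓕 F' F

/-- The collection `𝒥(F)` of good intervals `J` with `π^s_𝓕 J = F` and `J ⋐ F`. -/
def Jcal (ε : ℝ) (r s : ℕ) (𝓕 : Set (ℤ × ℤ)) (F : ℤ × ℤ) : Set (ℤ × ℤ) :=
  {J | IsGood ε r J ∧ PiIter 𝓕 s J F ∧ cSub r J F}

/-- The maximal intervals `𝒥*(F)` of `𝒥(F)`. -/
def Jstar (ε : ℝ) (r s : ℕ) (𝓕 : Set (ℤ × ℤ)) (F : ℤ × ℤ) : Set (ℤ × ℤ) :=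
  {J ∈ Jcal ε r s 𝓕 F | ∀ J' ∈ Jcal ε r s 𝓕 F, dset J ⊆ dset J' → J' = J}

/-- The projection `P^w_{F,J} φ = Σ_{J' ∈ 𝓙, J' ⊆ J} Δ^w_{J'} φ`. -/
def projIn (w : Measure ℝ) (𝓙 : Set (ℤ × ℤ)) (J : ℤ × ℤ) (φ : ℝ → ℝ) (x : ℝ) : ℝ :=
  ∑' J' : {J' // J' ∈ 𝓙 ∧ dset J' ⊆ dset J}, haarProj w J'.1 φ x

/-- `‖P^w_{F,J} φ‖²_{L²(w)}`. -/
def projNormSq (w : Measure ℝ) (𝓙 : Set (ℤ × ℤ)) (J : ℤ × ℤ) (φ : ℝ → ℝ) : ℝ≥0∞ :=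
  ∫⁻ x, ENNReal.ofReal (projIn w 𝓙 J φ x ^ 2) ∂w

/-- A function is good when (up to null sets) its Haar expansion uses only good intervals. -/
def GoodFn (ε : ℝ) (r : ℕ) (μ : Measure ℝ) (f : ℝ → ℝ) : Prop :=
  f =ᵐ[μ] fun x => ∑' I : {I : ℤ × ℤ // IsGood ε r I}, haarProj μ I.1 f x

end TwoWeight

namespace TwoWeight

/-- Best constant in the two-weight inequality for the hard truncations. -/
def Nhard (σ w : Measure ℝ) : ℝ≥0∞ :=
  sInf {N : ℝ≥0∞ | ∀ (f : ℝ → ℝ) (ε δ : ℝ), 0 < ε → ε < δ →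
    sqInt w (Hhard σ f ε δ) ≤ N ^ 2 * sqInt σ f}

/-- Best constant in the two-weight inequality for the smooth truncations. -/
def Nsmooth (σ w : Measure ℝ) : ℝ≥0∞ :=
  sInf {N : ℝ≥0∞ | ∀ (f : ℝ → ℝ) (α β : ℝ), 0 < α → α < β →
    sqInt w (Hsm σ f α β) ≤ N ^ 2 * sqInt σ f}

/-- The convolution-type operator `f ↦ ∫ k(y-x) f(y) dσ(y)` with kernel `k`. -/
def kerOp (σ : Measure ℝ) (k : ℝ → ℝ) (f : ℝ → ℝ) (x : ℝ) : ℝ :=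
  ∫ y, k (y - x) * f y ∂σ

/-- The unnormalized moving average `∫_{|y-x| ≤ r} |f| dσ`. -/
def ballInt (σ : Measure ℝ) (r : ℝ) (f : ℝ → ℝ) (x : ℝ) : ℝ≥0∞ :=
  ∫⁻ y in closedBall x r, ‖f y‖ₑ ∂σ

/-- The hard truncation kernel. -/
def hardKer (ε δ : ℝ) : ℝ → ℝ := {t : ℝ | ε < |t| ∧ |t| < δ}.indicator fun t => 1 / t

lemma Hhard_eq_kerOp (σ : Measure ℝ) (f : ℝ → ℝ) (ε δ : ℝ) :
    Hhard σ f ε δ = kerOp σ (hardKer ε δ) f := by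
  funext x
  have hm : MeasurableSet {y : ℝ | ε < |y - x| ∧ |y - x| < δ} := by measurability
  rw [Hhard, kerOp, ← integral_indicator hm]
  congr 1
  funext y
  by_cases h : ε < |y - x| ∧ |y - x| < δ
  · rw [indicator_of_mem (by exact h), hardKer, indicator_of_mem (by exact h)]; ring
  · rw [indicator_of_notMem (by exact h), hardKer, indicator_of_notMem (by exact h)]; ring

lemma sqInt_eq (μ : Measure ℝ) (f : ℝ → ℝ) : sqInt μ f = ∫⁻ x, ‖f x‖ₑ ^ 2 ∂μ := by
  refine lintegral_congr fun x => ?_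
  rw [← sq_abs, ENNReal.ofReal_pow (abs_nonneg _), Real.enorm_eq_ofReal_abs]

/-- For a kernel with open support, an arbitrary function may be replaced by a measurable one of
no larger norm, without decreasing the absolute value of the operator anywhere. -/
lemma exists_measurable_majorant (σ : Measure ℝ) {k : ℝ → ℝ} (hk : Measurable k)
    (hs : IsOpen (Function.support k)) (f : ℝ → ℝ) :
    ∃ g : ℝ → ℝ, Measurable g ∧ sqInt σ g ≤ sqInt σ f ∧
      ∀ x, ‖kerOp σ k f x‖ₑ ≤ ‖kerOp σ k g x‖ₑ := by
  set U : Set ℝ := {x | AEStronglyMeasurable (fun y => k (y - x) * f y) σ} with hU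
  set S : ℝ → Set ℝ := fun x => {y | k (y - x) ≠ 0} with hS
  have hSo : ∀ x, IsOpen (S x) := fun x => hs.preimage (continuous_id.sub continuous_const)
  obtain ⟨T, hTU, hTc, hT⟩ := TopologicalSpace.isOpen_biUnion_countable U S fun x _ => hSo x
  set V := ⋃ x ∈ U, S x with hV
  have hVm : MeasurableSet V := (isOpen_biUnion fun x _ => hSo x).measurableSet
  have hf : ∀ x ∈ U, AEStronglyMeasurable f (σ.restrict (S x)) := by
    intro x hx
    have h1 : AEStronglyMeasurable (fun y => (k (y - x))⁻¹ * (k (y - x) * f y))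
        (σ.restrict (S x)) :=
      (hk.comp (measurable_id.sub_const x)).inv.aestronglyMeasurable.mul hx.restrict
    refine h1.congr ?_
    filter_upwards [ae_restrict_mem (hSo x).measurableSet] with y hy
    exact inv_mul_cancel_left₀ hy _
  have hfV : AEStronglyMeasurable f (σ.restrict V) := by
    rw [← hT]
    have := hTc.to_subtype
    rw [biUnion_eq_iUnion, aestronglyMeasurable_iUnion_iff]
    exact fun x => hf x (hTU x.2)
  have hg : V.indicator (hfV.mk f) =ᵐ[σ] V.indicator f := by
    have := (ae_restrict_iff' hVm).1 hfV.ae_eq_mk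
    filter_upwards [this] with y hy
    by_cases h : y ∈ V
    · simp [h, hy h]
    · simp [h]
  refine ⟨V.indicator (hfV.mk f), hfV.stronglyMeasurable_mk.measurable.indicator hVm, ?_, ?_⟩
  · rw [sqInt_eq, sqInt_eq]
    refine (lintegral_congr_ae (g := fun y => ‖V.indicator f y‖ₑ ^ 2) ?_).trans_le
      (lintegral_mono fun y => ?_)
    · filter_upwards [hg] with y hy
      rw [hy]
    · gcongr
      by_cases h : y ∈ V <;> simp [h]
  · intro x
    by_cases hx : x ∈ U
    · refine le_of_eq (congrArg _ (integral_congr_ae ?_))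
      filter_upwards [hg] with y hy
      rw [hy]
      by_cases h : y ∈ V
      · simp [h]
      · have : k (y - x) = 0 := by
          by_contra h0
          exact h (mem_biUnion hx h0)
        simp [this]
    · rw [kerOp, integral_undef fun h => hx h.aestronglyMeasurable]
      simp

lemma measure_Icc_div_le_Pois (μ : Measure ℝ) {a b : ℝ} (hab : a < b) :
    ENNReal.ofReal (1 / (b - a)) * μ (Icc a b) ≤ Pois μ (Ioo a b) (b - a) := by
  rw [Pois, ← setLIntegral_const]
  refine (setLIntegral_mono' measurableSet_Icc fun x hx => ?_).trans (setLIntegral_le_lintegral _ _)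
  have h0 : infDist x (Ioo a b) = 0 := by
    rw [← infDist_closure, closure_Ioo hab.ne]
    exact infDist_zero_of_mem hx
  have : b - a ≠ 0 := by linarith
  rw [h0]
  apply le_of_eq
  congr 1
  field_simp
  ring

lemma A2cond.measure_closedBall_mul_le {σ w : Measure ℝ} {A2 : ℝ} (h : A2cond σ w A2)
    {r : ℝ} (hr : 0 < r) (y : ℝ) :
    ENNReal.ofReal (1 / r) ^ 2 * (σ (closedBall y (2 * r)) * w (closedBall y r))
      ≤ ENNReal.ofReal (16 * A2) := by
  have hab : y - 2 * r < y + 2 * r := by linarith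
  have key := (mul_le_mul' (measure_Icc_div_le_Pois σ hab) (measure_Icc_div_le_Pois w hab)).trans
    (h _ _ hab)
  have e : ENNReal.ofReal (1 / r) = 4 * ENNReal.ofReal (1 / (y + 2 * r - (y - 2 * r))) := by
    rw [show (4 : ℝ≥0∞) = ENNReal.ofReal 4 by simp, ← ENNReal.ofReal_mul (by norm_num)]
    congr 1
    field_simp
    ring
  rw [Real.closedBall_eq_Icc, e]
  set c := ENNReal.ofReal (1 / (y + 2 * r - (y - 2 * r)))
  calc _ ≤ (4 * c) ^ 2 * (σ (Icc (y - 2 * r) (y + 2 * r)) * w (Icc (y - 2 * r) (y + 2 * r))) := by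
        gcongr
        rw [Real.closedBall_eq_Icc]
        exact Icc_subset_Icc (by linarith) (by linarith)
    _ = 16 * (c * σ (Icc (y - 2 * r) (y + 2 * r)) * (c * w (Icc (y - 2 * r) (y + 2 * r)))) := by
        ring
    _ ≤ 16 * ENNReal.ofReal A2 := by gcongr
    _ = _ := by rw [ENNReal.ofReal_mul (by norm_num)]; simp

lemma measurable_ballInt (σ : Measure ℝ) [SFinite σ] (r : ℝ) {f : ℝ → ℝ} (hf : Measurable f) :
    Measurable (ballInt σ r f) := by
  have : ballInt σ r f = fun x => ∫⁻ y,
      ({p : ℝ × ℝ | dist p.2 p.1 ≤ r}.indicator (fun p => ‖f p.2‖ₑ)) (x, y) ∂σ := by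
    funext x
    rw [ballInt, ← lintegral_indicator measurableSet_closedBall]
    rfl
  rw [this]
  refine Measurable.lintegral_prod_right' ?_
  exact (by fun_prop : Measurable fun p : ℝ × ℝ => ‖f p.2‖ₑ).indicator
    (measurableSet_le (by fun_prop) measurable_const)

lemma sq_ballInt_le (σ : Measure ℝ) (r : ℝ) {f : ℝ → ℝ} (hf : Measurable f) (x : ℝ) :
    ballInt σ r f x ^ 2 ≤ σ (closedBall x r) * ∫⁻ y in closedBall x r, ‖f y‖ₑ ^ 2 ∂σ := by
  have h := ENNReal.lintegral_mul_le_Lp_mul_Lq (σ.restrict (closedBall x r))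
    Real.HolderConjugate.two_two (f := fun _ => 1) (g := fun y => ‖f y‖ₑ)
    aemeasurable_const hf.enorm.aemeasurable
  simp only [Pi.mul_apply, one_mul, ENNReal.rpow_two, one_pow, lintegral_one,
    Measure.restrict_apply_univ] at h
  calc _ ≤ (_ : ℝ≥0∞) ^ 2 := pow_le_pow_left' h 2
    _ = _ := by
      simp only [mul_pow, ← ENNReal.rpow_mul_natCast]
      norm_num

lemma ballInt_lt_top (σ : Measure ℝ) [IsLocallyFiniteMeasure σ] (r : ℝ) {f : ℝ → ℝ}
    (hf : Measurable f) (hf2 : sqInt σ f < ∞) (x : ℝ) : ballInt σ r f x < ∞ := by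
  rw [sqInt_eq] at hf2
  have h := (sq_ballInt_le σ r hf x).trans_lt (ENNReal.mul_lt_top measure_closedBall_lt_top
    ((setLIntegral_le_lintegral _ _).trans_lt hf2))
  by_contra h'
  rw [not_lt_top_iff] at h'
  simp [h'] at h

lemma A2cond.lintegral_sq_ballInt_le {σ w : Measure ℝ} [SFinite σ] [SFinite w] {A2 : ℝ}
    (h : A2cond σ w A2) {r : ℝ} (hr : 0 < r) {f : ℝ → ℝ} (hf : Measurable f) :
    ∫⁻ x, (ENNReal.ofReal (1 / r) * ballInt σ r f x) ^ 2 ∂w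
      ≤ ENNReal.ofReal (16 * A2) * sqInt σ f := by
  set c := ENNReal.ofReal (1 / r) with hc
  have hball : Measurable fun p : ℝ × ℝ =>
      {p : ℝ × ℝ | dist p.2 p.1 ≤ r}.indicator (fun p => ‖f p.2‖ₑ ^ 2) p :=
    (by fun_prop : Measurable fun p : ℝ × ℝ => ‖f p.2‖ₑ ^ 2).indicator
      (measurableSet_le (by fun_prop) measurable_const)
  have hσ : Measurable fun x => σ (closedBall x r) := by
    have := measurable_ballInt σ r (f := fun _ => 1) measurable_const
    have e : ballInt σ r (fun _ => 1) = fun x => σ (closedBall x r) := by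
      funext x
      simp [ballInt]
    rwa [e] at this
  calc ∫⁻ x, (c * ballInt σ r f x) ^ 2 ∂w
      ≤ ∫⁻ x, ∫⁻ y, c ^ 2 * (σ (closedBall x r) *
          {p : ℝ × ℝ | dist p.2 p.1 ≤ r}.indicator (fun p => ‖f p.2‖ₑ ^ 2) (x, y)) ∂σ ∂w := by
        refine lintegral_mono fun x => ?_
        have hx : Measurable fun y =>
          {p : ℝ × ℝ | dist p.2 p.1 ≤ r}.indicator (fun p => ‖f p.2‖ₑ ^ 2) (x, y) :=
          hball.comp measurable_prodMk_left
        rw [lintegral_const_mul _ (hx.const_mul _), lintegral_const_mul _ hx, mul_pow]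
        gcongr
        refine (sq_ballInt_le σ r hf x).trans_eq ?_
        rw [← lintegral_indicator measurableSet_closedBall]
        rfl
    _ = ∫⁻ y, ∫⁻ x, c ^ 2 * (σ (closedBall x r) *
          {p : ℝ × ℝ | dist p.2 p.1 ≤ r}.indicator (fun p => ‖f p.2‖ₑ ^ 2) (x, y)) ∂w ∂σ :=
        lintegral_lintegral_swap
          (((hσ.comp measurable_fst).mul hball).const_mul _).aemeasurable
    _ ≤ ∫⁻ y, ENNReal.ofReal (16 * A2) * ‖f y‖ₑ ^ 2 ∂σ := by
        refine lintegral_mono fun y => ?_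
        calc _ ≤ ∫⁻ x in closedBall y r,
              c ^ 2 * (σ (closedBall y (2 * r)) * ‖f y‖ₑ ^ 2) ∂w := by
              rw [← lintegral_indicator measurableSet_closedBall]
              refine lintegral_mono fun x => ?_
              by_cases hx : dist y x ≤ r
              · rw [indicator_of_mem (by exact hx),
                  indicator_of_mem (by rwa [mem_closedBall, dist_comm])]
                gcongr
                refine closedBall_subset_closedBall' ?_
                rw [dist_comm]; linarith
              · rw [indicator_of_notMem (by exact hx)]
                simp
          _ = c ^ 2 * (σ (closedBall y (2 * r)) * w (closedBall y r)) * ‖f y‖ₑ ^ 2 := by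
              rw [setLIntegral_const]; ring
          _ ≤ _ := by
              gcongr
              exact h.measure_closedBall_mul_le hr y
    _ = _ := by rw [lintegral_const_mul _ (by fun_prop), sqInt_eq]

lemma rpow_half_le_of_le_sq_mul {X a s : ℝ≥0∞} (h : X ≤ a ^ 2 * s) :
    X ^ (1 / 2 : ℝ) ≤ a * s ^ (1 / 2 : ℝ) := by
  refine (ENNReal.rpow_le_rpow h (by norm_num)).trans_eq ?_
  rw [ENNReal.mul_rpow_of_nonneg _ _ (by norm_num), ← ENNReal.rpow_two, ← ENNReal.rpow_mul]
  norm_num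

lemma integrable_kernel_mul (σ : Measure ℝ) [IsLocallyFiniteMeasure σ] {k g : ℝ → ℝ}
    (hk : Measurable k) {c R : ℝ} (hb : ∀ t, |k t| ≤ c) (hs : ∀ t, R < |t| → k t = 0)
    (hg : Measurable g) (hg2 : sqInt σ g < ∞) (x : ℝ) :
    Integrable (fun y => k (y - x) * g y) σ := by
  have hkx : Measurable fun y => k (y - x) := hk.comp (measurable_id.sub_const x)
  refine ⟨(hkx.mul hg).aestronglyMeasurable, ?_⟩
  rw [hasFiniteIntegral_iff_enorm]
  calc _ ≤ ∫⁻ y in closedBall x R, ENNReal.ofReal c * ‖g y‖ₑ ∂σ := by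
        rw [← lintegral_indicator measurableSet_closedBall]
        refine lintegral_mono fun y => ?_
        by_cases hy : y ∈ closedBall x R
        · rw [indicator_of_mem hy, enorm_mul]
          gcongr
          rw [Real.enorm_eq_ofReal_abs]
          exact ENNReal.ofReal_le_ofReal (hb _)
        · rw [mem_closedBall, Real.dist_eq, not_le] at hy
          simp [hs _ hy]
    _ = ENNReal.ofReal c * ballInt σ R g x := by rw [lintegral_const_mul _ hg.enorm, ballInt]
    _ < ∞ := ENNReal.mul_lt_top ENNReal.ofReal_lt_top (ballInt_lt_top σ R hg hg2 x)

lemma enorm_kerOp_sub_le (σ : Measure ℝ) {k g : ℝ → ℝ} {ε δ : ℝ}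
    (hd : ∀ t, |k t| ≤ (if |t| ≤ ε then 2 * (1 / ε) else 0) +
      if |t| ≤ 2 * δ then 2 * (1 / (2 * δ)) else 0) (hε : 0 < ε) (hδ : 0 < δ)
    (hg : Measurable g) (x : ℝ) :
    ‖kerOp σ k g x‖ₑ ≤ 2 * (ENNReal.ofReal (1 / ε) * ballInt σ ε g x) +
      2 * (ENNReal.ofReal (1 / (2 * δ)) * ballInt σ (2 * δ) g x) := by
  refine (enorm_integral_le_lintegral_enorm _).trans ?_
  have key : ∀ r, 0 < r → ∫⁻ y, ENNReal.ofReal (if |y - x| ≤ r then 2 * (1 / r) else 0) * ‖g y‖ₑ ∂σ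
      = 2 * (ENNReal.ofReal (1 / r) * ballInt σ r g x) := by
    intro r hr
    rw [ballInt, ← lintegral_const_mul _ hg.enorm, ← lintegral_const_mul _ (by fun_prop),
      ← lintegral_indicator measurableSet_closedBall]
    refine lintegral_congr fun y => ?_
    by_cases hy : |y - x| ≤ r
    · rw [indicator_of_mem (by rwa [mem_closedBall, Real.dist_eq]), if_pos hy,
        ENNReal.ofReal_mul (by norm_num), mul_assoc]
      simp
    · rw [indicator_of_notMem (by rwa [mem_closedBall, Real.dist_eq]), if_neg hy]
      simp
  rw [← key ε hε, ← key (2 * δ) (by linarith), ← lintegral_add_left]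
  · refine lintegral_mono fun y => ?_
    rw [enorm_mul, ← add_mul]
    gcongr
    rw [Real.enorm_eq_ofReal_abs]
    refine (ENNReal.ofReal_le_ofReal (hd _)).trans ENNReal.ofReal_add_le
  · refine Measurable.mul ?_ hg.enorm
    exact (Measurable.ite (measurableSet_le (by fun_prop) measurable_const) measurable_const
      measurable_const).ennreal_ofReal

/-- Kernels whose difference is dominated by two normalized ball averages have operator norms
differing by at most `16 𝒜₂^{1/2}`. -/
lemma A2cond.sqInt_kerOp_le {σ w : Measure ℝ} [IsLocallyFiniteMeasure σ]
    [IsLocallyFiniteMeasure w] {A2 : ℝ} (hA : 0 ≤ A2) (h : A2cond σ w A2) {k₁ k₂ : ℝ → ℝ}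
    (hk₁ : Measurable k₁) (hk₂ : Measurable k₂) (ho : IsOpen (Function.support k₁))
    {c R ε δ : ℝ} (hb₁ : ∀ t, |k₁ t| ≤ c) (hs₁ : ∀ t, R < |t| → k₁ t = 0)
    (hb₂ : ∀ t, |k₂ t| ≤ c) (hs₂ : ∀ t, R < |t| → k₂ t = 0)
    (hε : 0 < ε) (hδ : 0 < δ)
    (hd : ∀ t, |k₁ t - k₂ t| ≤ (if |t| ≤ ε then 2 * (1 / ε) else 0) +
      if |t| ≤ 2 * δ then 2 * (1 / (2 * δ)) else 0)
    {N M : ℝ≥0∞} (hM : M ≠ 0) (hNM : N + ENNReal.ofReal (16 * √A2) ≤ M)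
    (hN : ∀ f : ℝ → ℝ, sqInt w (kerOp σ k₂ f) ≤ N ^ 2 * sqInt σ f) (f : ℝ → ℝ) :
    sqInt w (kerOp σ k₁ f) ≤ M ^ 2 * sqInt σ f := by
  rcases eq_or_ne (sqInt σ f) ∞ with hf | hf
  · rw [hf, ENNReal.mul_top (pow_ne_zero 2 hM)]
    exact le_top
  obtain ⟨g, hg, hgf, hle⟩ := exists_measurable_majorant σ hk₁ ho f
  have hg2 : sqInt σ g < ∞ := hgf.trans_lt hf.lt_top
  set F : ℝ → ℝ≥0∞ := fun x => ‖kerOp σ k₂ g x‖ₑ with hF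
  set A : ℝ → ℝ → ℝ≥0∞ := fun r x => ENNReal.ofReal (1 / r) * ballInt σ r g x with hAdef
  have hFm : Measurable F := by
    refine StronglyMeasurable.enorm (StronglyMeasurable.integral_prod_right'
      (f := fun p : ℝ × ℝ => k₂ (p.2 - p.1) * g p.2) ?_)
    exact ((hk₂.comp (measurable_snd.sub measurable_fst)).mul
      (hg.comp measurable_snd)).stronglyMeasurable
  have hAm : ∀ r, Measurable (A r) := fun r => (measurable_ballInt σ r hg).const_mul _
  have hpt : ∀ x, ‖kerOp σ k₁ f x‖ₑ ≤
      (F + ((fun x => 2 * A ε x) + fun x => 2 * A (2 * δ) x)) x := by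
    intro x
    refine (hle x).trans ?_
    have e : kerOp σ k₁ g x = kerOp σ k₂ g x + kerOp σ (fun t => k₁ t - k₂ t) g x := by
      have i₁ := integrable_kernel_mul σ hk₁ hb₁ hs₁ hg hg2 x
      have i₂ := integrable_kernel_mul σ hk₂ hb₂ hs₂ hg hg2 x
      simp only [kerOp, sub_mul]
      rw [integral_sub i₁ i₂]
      ring
    rw [e]
    refine (enorm_add_le _ _).trans ?_
    exact add_le_add le_rfl (enorm_kerOp_sub_le σ hd hε hδ hg x)
  set s := sqInt σ g
  have hAbd : ∀ r, 0 < r → (∫⁻ x, (2 * A r x) ^ (2 : ℝ) ∂w) ^ (1 / 2 : ℝ) ≤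
      ENNReal.ofReal (8 * √A2) * s ^ (1 / 2 : ℝ) := by
    intro r hr
    refine rpow_half_le_of_le_sq_mul ?_
    simp only [ENNReal.rpow_two, mul_pow]
    rw [lintegral_const_mul _ (by have := hAm r; fun_prop)]
    calc _ ≤ 2 ^ 2 * (ENNReal.ofReal (16 * A2) * s) :=
          mul_le_mul_right (h.lintegral_sq_ballInt_le hr hg) _
      _ = _ := by
          rw [← mul_assoc]
          congr 1
          rw [← ENNReal.ofReal_pow (by positivity), mul_pow, Real.sq_sqrt hA,
            show (2 : ℝ≥0∞) ^ 2 = ENNReal.ofReal 4 by norm_num,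
            ← ENNReal.ofReal_mul (by norm_num)]
          congr 1
          ring
  have hFbd : (∫⁻ x, F x ^ (2 : ℝ) ∂w) ^ (1 / 2 : ℝ) ≤ N * s ^ (1 / 2 : ℝ) := by
    refine rpow_half_le_of_le_sq_mul ?_
    simp only [ENNReal.rpow_two]
    exact (sqInt_eq w _).symm.trans_le (hN g)
  have hmain : (∫⁻ x, ((F + ((fun x => 2 * A ε x) + fun x => 2 * A (2 * δ) x)) x) ^ (2 : ℝ) ∂w)
      ^ (1 / 2 : ℝ) ≤ M * s ^ (1 / 2 : ℝ) := by
    have m₁ := ((hAm ε).const_mul 2).aemeasurable (μ := w)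
    have m₂ := ((hAm (2 * δ)).const_mul 2).aemeasurable (μ := w)
    calc _ ≤ _ := ENNReal.lintegral_Lp_add_le hFm.aemeasurable (m₁.add m₂) one_le_two
      _ ≤ _ := add_le_add le_rfl (ENNReal.lintegral_Lp_add_le m₁ m₂ one_le_two)
      _ ≤ N * s ^ (1 / 2 : ℝ) + (ENNReal.ofReal (8 * √A2) * s ^ (1 / 2 : ℝ) +
          ENNReal.ofReal (8 * √A2) * s ^ (1 / 2 : ℝ)) :=
        add_le_add hFbd (add_le_add (hAbd ε hε) (hAbd (2 * δ) (by linarith)))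
      _ = (N + ENNReal.ofReal (16 * √A2)) * s ^ (1 / 2 : ℝ) := by
        rw [show 16 * √A2 = 8 * √A2 + 8 * √A2 by ring,
          ENNReal.ofReal_add (by positivity) (by positivity)]
        ring
      _ ≤ _ := by gcongr
  rw [sqInt_eq]
  calc _ ≤ ∫⁻ x, ((F + ((fun x => 2 * A ε x) + fun x => 2 * A (2 * δ) x)) x) ^ (2 : ℝ) ∂w := by
        refine lintegral_mono fun x => ?_
        rw [ENNReal.rpow_two]
        exact pow_le_pow_left' (hpt x) 2
    _ = ((∫⁻ x, ((F + ((fun x => 2 * A ε x) + fun x => 2 * A (2 * δ) x)) x) ^ (2 : ℝ) ∂w)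
        ^ (1 / 2 : ℝ)) ^ (2 : ℝ) := by
        rw [← ENNReal.rpow_mul]; norm_num
    _ ≤ (M * s ^ (1 / 2 : ℝ)) ^ (2 : ℝ) := ENNReal.rpow_le_rpow hmain (by norm_num)
    _ = M ^ 2 * s := by
        rw [ENNReal.mul_rpow_of_nonneg _ _ (by norm_num), ← ENNReal.rpow_mul]; norm_num
    _ ≤ _ := by gcongr

lemma measurable_hardKer (ε δ : ℝ) : Measurable (hardKer ε δ) :=
  (measurable_const.div measurable_id).indicator (by measurability)

lemma measurable_Kab (α β : ℝ) : Measurable (Kab α β) := by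
  have h0 : Measurable (K0 α β) := by
    unfold K0
    refine Measurable.ite measurableSet_Iio (by fun_prop) ?_
    refine Measurable.ite measurableSet_Iic (by fun_prop) ?_
    exact Measurable.ite measurableSet_Iio (by fun_prop) measurable_const
  unfold Kab
  refine Measurable.ite measurableSet_Ioi h0 ?_
  exact Measurable.ite measurableSet_Iio (h0.comp measurable_neg).neg measurable_const

lemma isOpen_support_hardKer {ε : ℝ} (hε : 0 < ε) (δ : ℝ) :
    IsOpen (Function.support (hardKer ε δ)) := by
  have : Function.support (hardKer ε δ) = {t : ℝ | ε < |t| ∧ |t| < δ} := by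
    rw [hardKer, support_indicator, inter_eq_left]
    intro t ht
    exact one_div_ne_zero (abs_pos.1 (hε.trans ht.1))
  rw [this]
  exact (isOpen_lt continuous_const continuous_abs).inter
    (isOpen_lt continuous_abs continuous_const)

lemma K0_pos {α β t : ℝ} (hα : 0 < α) (hαβ : α < β) (ht : 0 < t) (htβ : t < 2 * β) :
    0 < K0 α β t := by
  have hβ := hα.trans hαβ
  unfold K0
  split_ifs with h1 h2
  · rw [show -t / α ^ 2 + 2 / α = (2 * α - t) / α ^ 2 by field_simp; ring]
    exact div_pos (by linarith) (by positivity)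
  · positivity
  · rw [show -t / β ^ 2 + 2 / β = (2 * β - t) / β ^ 2 by field_simp; ring]
    exact div_pos (by linarith) (by positivity)

lemma K0_eq_zero {α β t : ℝ} (hα : 0 < α) (hαβ : α < β) (htβ : 2 * β ≤ t) :
    K0 α β t = 0 := by
  unfold K0
  rw [if_neg (by linarith), if_neg (by linarith), if_neg (by linarith)]

lemma Kab_neg (α β t : ℝ) : Kab α β (-t) = -Kab α β t := by
  unfold Kab
  rcases lt_trichotomy t 0 with h | h | h
  · simp [h, not_lt.2 h.le]
  · simp [h]
  · simp [h, not_lt.2 h.le]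

lemma hardKer_neg (ε δ t : ℝ) : hardKer ε δ (-t) = -hardKer ε δ t := by
  by_cases h : ε < |t| ∧ |t| < δ
  · simp [hardKer, h, inv_neg]
  · simp [hardKer, h]

lemma isOpen_support_Kab {α β : ℝ} (hα : 0 < α) (hαβ : α < β) :
    IsOpen (Function.support (Kab α β)) := by
  have : Function.support (Kab α β) = {t : ℝ | t ≠ 0 ∧ |t| < 2 * β} := by
    ext t
    have key : ∀ u : ℝ, 0 < u → (K0 α β u ≠ 0 ↔ u < 2 * β) := fun u hu =>
      ⟨fun h => not_le.1 fun h' => h (K0_eq_zero hα hαβ h'), fun h => (K0_pos hα hαβ hu h).ne'⟩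
    rw [Function.mem_support, mem_ofPred_eq]
    unfold Kab
    rcases lt_trichotomy t 0 with h | h | h
    · rw [if_neg h.not_gt, if_pos h, neg_ne_zero, key _ (neg_pos.2 h), abs_of_neg h]
      exact (and_iff_right h.ne).symm
    · simp [h]
    · rw [if_pos h, key _ h, abs_of_pos h]
      exact (and_iff_right h.ne').symm
  rw [this]
  exact isOpen_ne.inter (isOpen_lt continuous_abs continuous_const)

lemma abs_hardKer_le {ε : ℝ} (hε : 0 < ε) (δ t : ℝ) : |hardKer ε δ t| ≤ 2 * (1 / ε) := by
  by_cases h : ε < |t| ∧ |t| < δ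
  · rw [hardKer, indicator_of_mem (by exact h), abs_div, abs_one]
    have := one_div_le_one_div_of_le hε h.1.le
    have : 0 < 1 / ε := by positivity
    linarith
  · rw [hardKer, indicator_of_notMem (by exact h), abs_zero]
    positivity

lemma abs_hardKer_sub_Kab_le {ε δ : ℝ} (hε : 0 < ε) (hεδ : ε < δ) (t : ℝ) :
    |hardKer ε δ t - Kab ε δ t| ≤ (if |t| ≤ ε then 2 * (1 / ε) else 0) +
      if |t| ≤ 2 * δ then 2 * (1 / (2 * δ)) else 0 := by
  have hδ := hε.trans hεδ
  wlog ht : 0 < t generalizing t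
  · rcases (not_lt.1 ht).eq_or_lt with h | h
    · simp only [h, hardKer, Kab]
      simp only [lt_self_iff_false, if_false, abs_zero, indicator, div_zero, ite_self, sub_self]
      rw [if_pos hε.le, if_pos (by linarith)]
      positivity
    · have := this (-t) (by linarith)
      rwa [hardKer_neg, Kab_neg, abs_neg, ← neg_sub', abs_neg] at this
  have hδ' : (2 : ℝ) * (1 / (2 * δ)) = 1 / δ := by field_simp
  have hp : 0 < 1 / ε := by positivity
  have hq : 0 < 1 / δ := by positivity
  rw [hδ', Kab, if_pos ht, abs_of_pos ht]
  by_cases h1 : t ≤ ε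
  · have hz : hardKer ε δ t = 0 :=
      indicator_of_notMem (fun h => by
        have := h.1; rw [abs_of_pos ht] at this; linarith) _
    rw [hz, if_pos h1, if_pos (by linarith), zero_sub, abs_neg,
      abs_of_pos (K0_pos hε hεδ ht (by linarith))]
    rcases h1.eq_or_lt with h | h
    · rw [K0, if_neg (by linarith), if_pos (by linarith), h]; linarith
    · rw [K0, if_pos h, neg_div]
      have : 0 < t / ε ^ 2 := by positivity
      have : 2 / ε = 2 * (1 / ε) := by ring
      linarith
  · rw [not_le] at h1
    rw [if_neg h1.not_ge]
    by_cases h2 : t < δ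
    · have hz : hardKer ε δ t = 1 / t :=
        indicator_of_mem (by rw [mem_ofPred_eq, abs_of_pos ht]; exact ⟨h1, h2⟩) _
      rw [hz, K0, if_neg h1.not_gt, if_pos h2.le, sub_self, abs_zero, if_pos (by linarith)]
      linarith
    · rw [not_lt] at h2
      have hz : hardKer ε δ t = 0 :=
        indicator_of_notMem (fun h => by
          have := h.2; rw [abs_of_pos ht] at this; linarith) _
      rw [hz, zero_sub, abs_neg]
      by_cases h3 : t < 2 * δ
      · rw [abs_of_pos (K0_pos hε hεδ ht h3), if_pos h3.le, K0, if_neg h1.not_gt, if_pos h3]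
        split_ifs with h4
        · rw [le_antisymm h4 h2]; linarith
        · rw [show -t / δ ^ 2 + 2 / δ = (2 * δ - t) / δ ^ 2 by field_simp; ring,
            zero_add, div_le_div_iff₀ (by positivity) hδ]
          nlinarith
      · rw [K0_eq_zero hε hεδ (not_lt.1 h3), abs_zero]
        split_ifs <;> linarith

lemma abs_Kab_le {α β : ℝ} (hα : 0 < α) (hαβ : α < β) (t : ℝ) : |Kab α β t| ≤ 5 * (1 / α) := by
  have h1 := abs_hardKer_sub_Kab_le hα hαβ t
  have h2 := abs_hardKer_le hα β t
  have hα' : 0 < 1 / α := by positivity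
  have h3 : 2 * (1 / (2 * β)) ≤ 1 / α := by
    rw [show 2 * (1 / (2 * β)) = 1 / β by field_simp]
    exact one_div_le_one_div_of_le hα hαβ.le
  have h4 : |Kab α β t| ≤ |hardKer α β t| + |hardKer α β t - Kab α β t| := by
    rw [abs_sub_comm]
    linarith [abs_sub_abs_le_abs_sub (Kab α β t) (hardKer α β t)]
  split_ifs at h1 <;> linarith

lemma Kab_eq_zero {α β t : ℝ} (hα : 0 < α) (hαβ : α < β) (ht : 2 * β < |t|) :
    Kab α β t = 0 := by
  unfold Kab
  split_ifs with h1 h2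
  · exact K0_eq_zero hα hαβ (by rw [abs_of_pos h1] at ht; exact ht.le)
  · rw [K0_eq_zero hα hαβ (by rw [abs_of_neg h2] at ht; exact ht.le), neg_zero]
  · rfl

lemma hardKer_eq_zero {ε δ t : ℝ} (hδ : 0 < δ) (ht : 2 * δ < |t|) : hardKer ε δ t = 0 :=
  indicator_of_notMem (fun h => by linarith [h.2]) _

lemma sInf_le_sInf_add {S T : Set ℝ≥0∞} {a : ℝ≥0∞}
    (h : ∀ N ∈ T, ∀ M, M ≠ 0 → N + a ≤ M → M ∈ S) : sInf S ≤ sInf T + a := by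
  refine le_of_forall_gt fun M hM => ?_
  obtain ⟨M', h1, h2⟩ := exists_between hM
  rw [ENNReal.sInf_add] at h1
  obtain ⟨N, hN, hNM⟩ := (by simpa [iInf_lt_iff] using h1 : ∃ N ∈ T, N + a < M')
  exact (sInf_le (h N hN M' (bot_le.trans_lt hNM).ne' hNM.le)).trans_lt h2

/-- Proposition 2.1.  Under the Poisson `A₂` condition, the best constants
for the hard and for the smooth truncations of the Hilbert transform differ by at most
`C·𝒜₂^{1/2}` with an absolute constant `C`; in particular one is finite iff the other is. -/
theorem statement1 :
    ∃ C : ℝ, 0 < C ∧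
      ∀ (σ w : Measure ℝ) (A2 : ℝ),
        IsLocallyFiniteMeasure σ → IsLocallyFiniteMeasure w →
        NoCommonMass σ w → 0 ≤ A2 → A2cond σ w A2 →
        Nhard σ w ≤ Nsmooth σ w + ENNReal.ofReal (C * Real.sqrt A2) ∧
        Nsmooth σ w ≤ Nhard σ w + ENNReal.ofReal (C * Real.sqrt A2) ∧
        (Nhard σ w < ∞ ↔ Nsmooth σ w < ∞) := by
  refine ⟨16, by norm_num, ?_⟩
  intro σ w A2 hσ hw _ hA h
  have h1 : Nhard σ w ≤ Nsmooth σ w + ENNReal.ofReal (16 * √A2) := by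
    refine sInf_le_sInf_add fun N hN M hM hNM f ε δ hε hεδ => ?_
    have hδ := hε.trans hεδ
    rw [Hhard_eq_kerOp]
    exact h.sqInt_kerOp_le (c := 5 * (1 / ε)) hA (measurable_hardKer ε δ) (measurable_Kab ε δ)
      (isOpen_support_hardKer hε δ)
      (fun t => (abs_hardKer_le hε δ t).trans (by gcongr; norm_num))
      (fun t => hardKer_eq_zero hδ) (abs_Kab_le hε hεδ) (fun t => Kab_eq_zero hε hεδ) hε hδ
      (abs_hardKer_sub_Kab_le hε hεδ) hM hNM (fun f => hN f ε δ hε hεδ) f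
  have h2 : Nsmooth σ w ≤ Nhard σ w + ENNReal.ofReal (16 * √A2) := by
    refine sInf_le_sInf_add fun N hN M hM hNM f ε δ hε hεδ => ?_
    have hδ := hε.trans hεδ
    exact h.sqInt_kerOp_le (c := 5 * (1 / ε)) hA (measurable_Kab ε δ) (measurable_hardKer ε δ)
      (isOpen_support_Kab hε hεδ) (abs_Kab_le hε hεδ) (fun t => Kab_eq_zero hε hεδ)
      (fun t => (abs_hardKer_le hε δ t).trans (by gcongr; norm_num))
      (fun t => hardKer_eq_zero hδ) hε hδ
      (fun t => abs_sub_comm (Kab ε δ t) _ ▸ abs_hardKer_sub_Kab_le hε hεδ t) hM hNM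
      (fun f => Hhard_eq_kerOp σ f ε δ ▸ hN f ε δ hε hεδ) f
  exact ⟨h1, h2, fun hf => h2.trans_lt (ENNReal.add_lt_top.2 ⟨hf, ENNReal.ofReal_lt_top⟩),
    fun hf => h1.trans_lt (ENNReal.add_lt_top.2 ⟨hf, ENNReal.ofReal_lt_top⟩)⟩

end TwoWeight
end
end

section
/- Let σ and w be locally finite positive Borel measures on ℝ satisfying the Poisson A₂ condition P(σ,I)·P(w,I) ≤ 𝒜₂ for all intervals I. Let I and J be intervals with disjoint interiors which share a common endpoint a, at which neither σ nor w has a point mass. Then sup_{0<α<β} |⟨H_{α,β}(1_I σ), 1_J⟩_w| ≤ C·𝒜₂^{1/2}·√(σ(I)·w(J)) for a constant C independent of I, J, α, β. -/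
open MeasureTheory Set Metric Filter
open scoped ENNReal NNReal

noncomputable section

namespace TwoWeight

/-- The smooth truncation kernel is dominated by the untruncated kernel. -/
lemma abs_Kab_neg_le {α β y : ℝ} (hα : 0 < α) (hαβ : α < β) (hy : 0 < y) :
    |Kab α β (-y)| ≤ 1 / y := by
  have key : ∀ c : ℝ, 0 < c → -y / c ^ 2 + 2 / c ≤ 1 / y := by
    intro c hc
    have h : 1 / y - (-y / c ^ 2 + 2 / c) = (c - y) ^ 2 / (y * c ^ 2) := by
      field_simp
      ring
    have h' : 0 ≤ (c - y) ^ 2 / (y * c ^ 2) := by positivity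
    linarith
  have pos : ∀ c : ℝ, 0 < c → y ≤ 2 * c → 0 ≤ -y / c ^ 2 + 2 / c := by
    intro c hc hyc
    have h : -y / c ^ 2 + 2 / c = (2 * c - y) / c ^ 2 := by
      field_simp
      ring
    rw [h]
    exact div_nonneg (by linarith) (by positivity)
  have hβ : 0 < β := hα.trans hαβ
  have hy' : ¬ (0 < -y) := by linarith
  have hy'' : -y < 0 := by linarith
  rw [Kab, if_neg hy', if_pos hy'', neg_neg, abs_neg, K0]
  split_ifs with h1 h2 h3
  · rw [abs_of_nonneg (pos α hα (by linarith))]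
    exact key α hα
  · rw [abs_of_nonneg (by positivity)]
  · rw [abs_of_nonneg (pos β hβ (by linarith))]
    exact key β hβ
  · simpa using hy.le

lemma measure_univ_sq_le (μ : Measure ℝ) [SFinite μ] :
    μ univ ^ 2 ≤ 2 * ∫⁻ y, μ (Iic y) ∂μ := by
  have hm : Measurable fun p : ℝ × ℝ => {p : ℝ × ℝ | p.2 ≤ p.1}.indicator (1 : ℝ × ℝ → ℝ≥0∞) p :=
    measurable_one.indicator (measurableSet_le measurable_snd measurable_fst)
  have h1 : ∀ y, ∫⁻ z, {p : ℝ × ℝ | p.2 ≤ p.1}.indicator (1 : ℝ × ℝ → ℝ≥0∞) (y, z) ∂μ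
      = μ (Iic y) := fun y => by
    rw [← lintegral_indicator_one measurableSet_Iic]
    rfl
  have hswap : ∫⁻ y, ∫⁻ z, {p : ℝ × ℝ | p.2 ≤ p.1}.indicator (1 : ℝ × ℝ → ℝ≥0∞) (z, y) ∂μ ∂μ
      = ∫⁻ y, μ (Iic y) ∂μ := by
    rw [lintegral_lintegral_swap (by exact (hm.comp measurable_swap).aemeasurable)]
    exact lintegral_congr h1
  calc μ univ ^ 2 = ∫⁻ _, ∫⁻ _, 1 ∂μ ∂μ := by simp [sq]
    _ ≤ ∫⁻ y, ∫⁻ z, ({p : ℝ × ℝ | p.2 ≤ p.1}.indicator (1 : ℝ × ℝ → ℝ≥0∞) (y, z) +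
          {p : ℝ × ℝ | p.2 ≤ p.1}.indicator (1 : ℝ × ℝ → ℝ≥0∞) (z, y)) ∂μ ∂μ := by
        refine lintegral_mono fun y => lintegral_mono fun z => ?_
        rcases le_total z y with h | h <;> simp [Set.indicator, h]
    _ = 2 * ∫⁻ y, μ (Iic y) ∂μ := by
        refine (lintegral_congr fun y => lintegral_add_left
          (f := fun z => {p : ℝ × ℝ | p.2 ≤ p.1}.indicator (1 : ℝ × ℝ → ℝ≥0∞) (y, z)) (hm.comp measurable_prodMk_left) _).trans ?_
        rw [lintegral_add_left hm.lintegral_prod_right', hswap, lintegral_congr h1, two_mul]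

/-- The Hardy inequality under a Muckenhoupt condition, tested on constant functions. -/
lemma lintegral_hardy_le (μ ν : Measure ℝ) [IsFiniteMeasure μ] [IsFiniteMeasure ν] (B : ℝ≥0∞)
    (H : ∀ r : ℝ, 0 < r →
      μ (Ioc 0 r) * ∫⁻ x in Ici r, ENNReal.ofReal (x ^ 2)⁻¹ ∂ν ≤ B) :
    ∫⁻ x in Ioi 0, μ (Ioc 0 x) * ENNReal.ofReal x⁻¹ ∂ν ≤
      (2 * B * μ univ * ν univ) ^ (1 / 2 : ℝ) := by
  have hS : Measurable fun x => μ (Ioc 0 x) :=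
    Monotone.measurable fun x y h => measure_mono (Ioc_subset_Ioc_right h)
  have hsq : ∀ x, μ (Ioc 0 x) ^ 2 ≤ 2 * ∫⁻ y in Ioc 0 x, μ (Ioc 0 y) ∂μ := by
    intro x
    refine (measure_univ_sq_le (μ.restrict (Ioc 0 x))).trans' (by simp) |>.trans ?_
    refine mul_le_mul_right (lintegral_mono fun y => ?_) 2
    rw [Measure.restrict_apply measurableSet_Iic]
    exact measure_mono fun z hz => ⟨hz.2.1, hz.1⟩
  have hset : MeasurableSet {p : ℝ × ℝ | p.2 ∈ Ioc 0 p.1} :=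
    (measurableSet_lt measurable_const measurable_snd).inter
      (measurableSet_le measurable_snd measurable_fst)
  have hm : Measurable fun p : ℝ × ℝ => ENNReal.ofReal (p.1 ^ 2)⁻¹ *
      {p : ℝ × ℝ | p.2 ∈ Ioc 0 p.1}.indicator (fun p => μ (Ioc 0 p.2)) p :=
    Measurable.mul (by fun_prop) ((hS.comp measurable_snd).indicator hset)
  have hL2 : ∫⁻ x in Ioi 0, (μ (Ioc 0 x) * ENNReal.ofReal x⁻¹) ^ 2 ∂ν ≤ 2 * B * μ univ := by
    calc ∫⁻ x in Ioi 0, (μ (Ioc 0 x) * ENNReal.ofReal x⁻¹) ^ 2 ∂ν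
        ≤ ∫⁻ x in Ioi 0, 2 * ∫⁻ y, ENNReal.ofReal (x ^ 2)⁻¹ *
            {p : ℝ × ℝ | p.2 ∈ Ioc 0 p.1}.indicator (fun p => μ (Ioc 0 p.2)) (x, y) ∂μ ∂ν := by
          refine setLIntegral_mono' measurableSet_Ioi fun x hx => ?_
          have hx : 0 < x := hx
          have e : ENNReal.ofReal x⁻¹ ^ 2 = ENNReal.ofReal (x ^ 2)⁻¹ := by
            rw [← ENNReal.ofReal_pow (by positivity), inv_pow]
          rw [mul_pow, e, lintegral_const_mul' _ _ ENNReal.ofReal_ne_top, ← mul_assoc,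
            mul_comm (2 : ℝ≥0∞), mul_assoc, mul_comm]
          gcongr
          refine (hsq x).trans (le_of_eq ?_)
          rw [← lintegral_indicator measurableSet_Ioc]
          rfl
      _ = 2 * ∫⁻ x in Ioi 0, ∫⁻ y, ENNReal.ofReal (x ^ 2)⁻¹ *
            {p : ℝ × ℝ | p.2 ∈ Ioc 0 p.1}.indicator (fun p => μ (Ioc 0 p.2)) (x, y) ∂μ ∂ν :=
          lintegral_const_mul _ hm.lintegral_prod_right'
      _ = 2 * ∫⁻ y, ∫⁻ x in Ioi 0, ENNReal.ofReal (x ^ 2)⁻¹ *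
            {p : ℝ × ℝ | p.2 ∈ Ioc 0 p.1}.indicator (fun p => μ (Ioc 0 p.2)) (x, y) ∂ν ∂μ := by
          rw [lintegral_lintegral_swap hm.aemeasurable]
      _ ≤ 2 * ∫⁻ _, B ∂μ := by
          gcongr with y
          rcases le_or_gt y 0 with hy | hy
          · simp [Set.indicator, hy.not_gt]
          refine le_trans (le_trans (setLIntegral_le_lintegral _ _) ?_) (H y hy)
          rw [← lintegral_const_mul' _ _ (measure_ne_top _ _),
            ← lintegral_indicator measurableSet_Ici]
          refine lintegral_mono fun x => ?_
          by_cases h : y ≤ x <;> simp [Set.indicator, h, hy, mul_comm]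
      _ = 2 * B * μ univ := by rw [lintegral_const, mul_assoc]
  have hCS := ENNReal.lintegral_mul_le_Lp_mul_Lq (ν.restrict (Ioi 0))
    (p := 2) (q := 2) (by constructor <;> norm_num)
    (f := fun x => μ (Ioc 0 x) * ENNReal.ofReal x⁻¹) (g := 1)
    (hS.mul (by fun_prop)).aemeasurable aemeasurable_const
  simp only [mul_one, Pi.one_apply, ENNReal.rpow_ofNat, Pi.mul_apply, lintegral_const, one_pow,
    one_mul, Measure.restrict_apply_univ] at hCS
  refine hCS.trans ?_
  rw [← ENNReal.mul_rpow_of_nonneg _ _ (by norm_num)]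
  exact ENNReal.rpow_le_rpow (mul_le_mul' hL2 (measure_mono (subset_univ _))) (by norm_num)

lemma mul_measure_le_Pois (σ : Measure ℝ) {c d : ℝ} (h : c < d) :
    ENNReal.ofReal (d - c)⁻¹ * σ (Icc c d) ≤ Pois σ (Ioo c d) (d - c) := by
  rw [Pois, ← setLIntegral_const]
  refine (setLIntegral_mono' measurableSet_Icc fun x hx => ?_).trans
    (setLIntegral_le_lintegral (Icc c d) _)
  have h0 : infDist x (Ioo c d) = 0 := by
    rw [← infDist_closure, closure_Ioo h.ne]
    exact infDist_zero_of_mem hx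
  rw [h0]
  apply ENNReal.ofReal_le_ofReal
  have : 0 < d - c := sub_pos.2 h
  apply le_of_eq
  field_simp
  ring

lemma mul_setLIntegral_le_Pois (w : Measure ℝ) {a c d : ℝ} (h : c < d) (ha : a ∈ Icc c d) :
    ENNReal.ofReal ((d - c) / 2) *
      ∫⁻ x in {x | d - c ≤ |x - a|}, ENNReal.ofReal ((x - a) ^ 2)⁻¹ ∂w
        ≤ Pois w (Ioo c d) (d - c) := by
  have hr : 0 < d - c := sub_pos.2 h
  have hs : MeasurableSet {x : ℝ | d - c ≤ |x - a|} :=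
    measurableSet_le measurable_const (by fun_prop)
  rw [Pois, ← lintegral_const_mul' _ _ ENNReal.ofReal_ne_top]
  refine (setLIntegral_mono' hs fun x hx => ?_).trans (setLIntegral_le_lintegral _ _)
  have hx : d - c ≤ |x - a| := hx
  have hd : infDist x (Ioo c d) ≤ |x - a| := by
    rw [← infDist_closure, closure_Ioo h.ne, ← Real.dist_eq]
    exact infDist_le_dist_of_mem ha
  have hn : 0 ≤ infDist x (Ioo c d) := infDist_nonneg
  rw [← ENNReal.ofReal_mul (by positivity)]
  apply ENNReal.ofReal_le_ofReal
  have h1 : (d - c) ^ 2 ≤ (x - a) ^ 2 := by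
    rw [← sq_abs (x - a)]
    gcongr
  have h2 : infDist x (Ioo c d) ^ 2 ≤ (x - a) ^ 2 := by
    rw [← sq_abs (x - a)]
    gcongr
  have h3 : 0 < (x - a) ^ 2 := lt_of_lt_of_le (by positivity) h1
  calc (d - c) / 2 * ((x - a) ^ 2)⁻¹ = (d - c) / (2 * (x - a) ^ 2) := by field_simp
    _ ≤ _ := by gcongr; linarith

/-- The Poisson `A₂` condition implies the Muckenhoupt condition at every point. -/
lemma A2cond.measure_mul_le {σ w : Measure ℝ} {A2 : ℝ} (hA : A2cond σ w A2)
    {a c d : ℝ} (h : c < d) (ha : a ∈ Icc c d) :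
    σ (Icc c d) * ∫⁻ x in {x | d - c ≤ |x - a|}, ENNReal.ofReal ((x - a) ^ 2)⁻¹ ∂w
      ≤ 2 * ENNReal.ofReal A2 := by
  have hr : 0 < d - c := sub_pos.2 h
  have hc : (2 : ℝ≥0∞) * (ENNReal.ofReal (d - c)⁻¹ * ENNReal.ofReal ((d - c) / 2)) = 1 := by
    rw [← ENNReal.ofReal_mul (by positivity), ← ENNReal.ofReal_ofNat 2,
      ← ENNReal.ofReal_mul (by positivity), ← ENNReal.ofReal_one]
    congr 1
    field_simp
  have := (mul_le_mul' (mul_measure_le_Pois σ h) (mul_setLIntegral_le_Pois w h ha)).trans (hA c d h)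
  calc _ = 2 * (ENNReal.ofReal (d - c)⁻¹ * ENNReal.ofReal ((d - c) / 2)) *
        (σ (Icc c d) * ∫⁻ x in {x | d - c ≤ |x - a|}, ENNReal.ofReal ((x - a) ^ 2)⁻¹ ∂w) := by
        rw [hc, one_mul]
    _ = 2 * ((ENNReal.ofReal (d - c)⁻¹ * σ (Icc c d)) * (ENNReal.ofReal ((d - c) / 2) *
          ∫⁻ x in {x | d - c ≤ |x - a|}, ENNReal.ofReal ((x - a) ^ 2)⁻¹ ∂w)) := by ring
    _ ≤ _ := by gcongr

lemma A2cond.symm {σ w : Measure ℝ} {A2 : ℝ} (hA : A2cond σ w A2) : A2cond w σ A2 :=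
  fun a b h => mul_comm (Pois σ _ _) _ ▸ hA a b h

/-- The bilinear form of the kernel `1 / (x + y)` is bounded under two-sided Muckenhoupt
conditions. -/
lemma lintegral_lintegral_inv_add_le (μ ν : Measure ℝ) [IsFiniteMeasure μ] [IsFiniteMeasure ν]
    (B : ℝ≥0∞)
    (H : ∀ r : ℝ, 0 < r → μ (Ioc 0 r) * ∫⁻ x in Ici r, ENNReal.ofReal (x ^ 2)⁻¹ ∂ν ≤ B)
    (H' : ∀ r : ℝ, 0 < r → ν (Ioc 0 r) * ∫⁻ x in Ici r, ENNReal.ofReal (x ^ 2)⁻¹ ∂μ ≤ B) :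
    ∫⁻ x in Ioi 0, ∫⁻ y in Ioi 0, ENNReal.ofReal (x + y)⁻¹ ∂μ ∂ν ≤
      2 * (2 * B * μ univ * ν univ) ^ (1 / 2 : ℝ) := by
  set F : ℝ × ℝ → ℝ≥0∞ :=
    {p : ℝ × ℝ | p.2 ≤ p.1}.indicator fun p => ENNReal.ofReal p.1⁻¹ with hF
  have hm : Measurable F :=
    Measurable.indicator (by fun_prop) (measurableSet_le measurable_snd measurable_fst)
  have hFint : ∀ (ρ : Measure ℝ) (x : ℝ), ∫⁻ y in Ioi 0, F (x, y) ∂ρ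
      = ρ (Ioc 0 x) * ENNReal.ofReal x⁻¹ := by
    intro ρ x
    have : (fun y => F (x, y)) = (Iic x).indicator fun _ => ENNReal.ofReal x⁻¹ := rfl
    rw [this, lintegral_indicator measurableSet_Iic, setLIntegral_const,
      Measure.restrict_apply measurableSet_Iic, mul_comm, inter_comm, Ioi_inter_Iic]
  calc _ ≤ ∫⁻ x in Ioi 0, ∫⁻ y in Ioi 0, (F (x, y) + F (y, x)) ∂μ ∂ν := by
        refine setLIntegral_mono' measurableSet_Ioi fun x hx =>
          setLIntegral_mono' measurableSet_Ioi fun y hy => ?_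
        have hx : 0 < x := hx
        have hy : 0 < y := hy
        rcases le_total y x with h | h
        · refine le_add_right ?_
          simp only [hF, Set.indicator, mem_ofPred_eq, h, if_true]
          exact ENNReal.ofReal_le_ofReal (inv_anti₀ hx (by linarith))
        · refine le_add_left ?_
          simp only [hF, Set.indicator, mem_ofPred_eq, h, if_true]
          exact ENNReal.ofReal_le_ofReal (inv_anti₀ hy (by linarith))
    _ = (∫⁻ x in Ioi 0, ∫⁻ y in Ioi 0, F (x, y) ∂μ ∂ν) +
          ∫⁻ y in Ioi 0, ∫⁻ x in Ioi 0, F (y, x) ∂ν ∂μ := by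
        refine (lintegral_congr fun x =>
          lintegral_add_left (f := fun y => F (x, y)) (hm.comp measurable_prodMk_left) _).trans ?_
        rw [lintegral_add_left hm.lintegral_prod_right']
        congr 1
        exact lintegral_lintegral_swap (hm.comp measurable_swap).aemeasurable
    _ ≤ _ := by
        simp_rw [hFint]
        rw [two_mul]
        refine add_le_add (lintegral_hardy_le μ ν B H)
          ((lintegral_hardy_le ν μ B H').trans (le_of_eq ?_))
        rw [mul_right_comm]

/-- Lemma 4.2, weak boundedness from `A₂`.  If the pair `(σ,w)` satisfies
the Poisson `A₂` condition, and `I = (p,a)`, `J = (a,q)` are adjacent intervals sharing the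
endpoint `a`, at which neither measure has a point mass, then
`sup_{0<α<β} |⟨H_{α,β}(1_I σ), 1_J⟩_w| ≤ C 𝒜₂^{1/2} (σ(I) w(J))^{1/2}`. -/
theorem statement3 :
    ∃ C : ℝ, 0 < C ∧
      ∀ (σ w : Measure ℝ) (A2 p a q : ℝ),
        IsLocallyFiniteMeasure σ → IsLocallyFiniteMeasure w →
        0 ≤ A2 → A2cond σ w A2 →
        p < a → a < q → σ {a} = 0 → w {a} = 0 →
        ∀ α β : ℝ, 0 < α → α < β →
          |∫ x in Ioo a q, HsmS σ (Ioo p a) α β x ∂w| ≤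
            C * Real.sqrt A2 * Real.sqrt ((σ (Ioo p a)).toReal * (w (Ioo a q)).toReal) := by
  refine ⟨4, by norm_num, fun σ w A2 p a q hσ hw hA2 hA hpa haq _ _ α β hα hαβ => ?_⟩
  have hσf : IsFiniteMeasure (σ.restrict (Ioo p a)) :=
    isFiniteMeasure_restrict.2 measure_Ioo_lt_top.ne
  have hwf : IsFiniteMeasure (w.restrict (Ioo a q)) :=
    isFiniteMeasure_restrict.2 measure_Ioo_lt_top.ne
  have hf : Measurable fun y : ℝ => a - y := by fun_prop
  have hg : Measurable fun x : ℝ => x - a := by fun_prop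
  set μ := (σ.restrict (Ioo p a)).map fun y => a - y with hμ
  set ν := (w.restrict (Ioo a q)).map fun x => x - a with hν
  have hμu : μ univ = σ (Ioo p a) := by
    rw [hμ, Measure.map_apply hf .univ]
    simp
  have hνu : ν univ = w (Ioo a q) := by
    rw [hν, Measure.map_apply hg .univ]
    simp
  have hsq : Measurable fun x : ℝ => ENNReal.ofReal (x ^ 2)⁻¹ := by fun_prop
  have H : ∀ r : ℝ, 0 < r → μ (Ioc 0 r) * ∫⁻ x in Ici r, ENNReal.ofReal (x ^ 2)⁻¹ ∂ν
      ≤ 2 * ENNReal.ofReal A2 := by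
    intro r hr
    refine le_trans (mul_le_mul' ?_ ?_)
      (hA.measure_mul_le (a := a) (c := a - r) (d := a) (by linarith) ⟨by linarith, le_rfl⟩)
    · rw [hμ, Measure.map_apply hf measurableSet_Ioc]
      refine (Measure.restrict_apply_le _ _).trans (measure_mono fun y hy => ?_)
      exact ⟨by linarith [hy.2], by linarith [hy.1]⟩
    · rw [hν, setLIntegral_map measurableSet_Ici hsq hg]
      refine (lintegral_mono' (Measure.restrict_mono subset_rfl Measure.restrict_le_self)
        le_rfl).trans (lintegral_mono_set fun x hx => ?_)
      have hx : r ≤ x - a := hx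
      exact le_trans (by linarith) (le_abs_self (x - a))
  have H' : ∀ r : ℝ, 0 < r → ν (Ioc 0 r) * ∫⁻ x in Ici r, ENNReal.ofReal (x ^ 2)⁻¹ ∂μ
      ≤ 2 * ENNReal.ofReal A2 := by
    intro r hr
    refine le_trans (mul_le_mul' ?_ ?_)
      (hA.symm.measure_mul_le (a := a) (c := a) (d := a + r) (by linarith)
        ⟨le_rfl, by linarith⟩)
    · rw [hν, Measure.map_apply hg measurableSet_Ioc]
      refine (Measure.restrict_apply_le _ _).trans (measure_mono fun y hy => ?_)
      exact ⟨by linarith [hy.1], by linarith [hy.2]⟩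
    · rw [hμ, setLIntegral_map measurableSet_Ici hsq hf]
      refine (lintegral_mono' (Measure.restrict_mono subset_rfl Measure.restrict_le_self)
        (fun x => by rw [← neg_sq, neg_sub])).trans (lintegral_mono_set fun x hx => ?_)
      have hx : r ≤ a - x := hx
      exact le_trans (by linarith) (neg_le_abs (x - a))
  have hmain := lintegral_lintegral_inv_add_le μ ν _ H H'
  have hker : ‖∫ x in Ioo a q, HsmS σ (Ioo p a) α β x ∂w‖ₑ ≤
      ∫⁻ x in Ioi 0, ∫⁻ y in Ioi 0, ENNReal.ofReal (x + y)⁻¹ ∂μ ∂ν := by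
    have hm : Measurable fun x : ℝ => ∫⁻ y in Ioi 0, ENNReal.ofReal (x + y)⁻¹ ∂μ :=
      Measurable.lintegral_prod_right' (f := fun p : ℝ × ℝ => ENNReal.ofReal (p.1 + p.2)⁻¹)
        (by fun_prop)
    have hJ : (fun x => x - a) ⁻¹' Ioi 0 ∩ Ioo a q = Ioo a q :=
      inter_eq_right.2 fun x hx => sub_pos.2 hx.1
    have hI : (fun y => a - y) ⁻¹' Ioi 0 ∩ Ioo p a = Ioo p a :=
      inter_eq_right.2 fun y hy => sub_pos.2 hy.2
    rw [hν, setLIntegral_map measurableSet_Ioi hm hg,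
      Measure.restrict_restrict (hg measurableSet_Ioi), hJ]
    refine (enorm_integral_le_lintegral_enorm _).trans
      (setLIntegral_mono' measurableSet_Ioo fun x hx => ?_)
    rw [hμ, setLIntegral_map measurableSet_Ioi (by fun_prop) hf,
      Measure.restrict_restrict (hf measurableSet_Ioi), hI]
    refine (enorm_integral_le_lintegral_enorm _).trans
      (setLIntegral_mono' measurableSet_Ioo fun y hy => ?_)
    rw [Real.enorm_eq_ofReal_abs]
    apply ENNReal.ofReal_le_ofReal
    have := abs_Kab_neg_le hα hαβ (y := x - y) (by linarith [hx.1, hy.2])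
    rw [neg_sub, one_div] at this
    rwa [sub_add_sub_cancel]
  have hfin := hker.trans hmain
  rw [hμu, hνu, ← ENNReal.ofReal_toReal (measure_Ioo_lt_top (μ := σ) (a := p) (b := a)).ne,
    ← ENNReal.ofReal_toReal (measure_Ioo_lt_top (μ := w) (a := a) (b := q)).ne,
    Real.enorm_eq_ofReal_abs, ← ENNReal.ofReal_ofNat 2,
    ← ENNReal.ofReal_mul (by positivity), ← ENNReal.ofReal_mul (by positivity),
    ← ENNReal.ofReal_mul (by positivity), ← ENNReal.ofReal_mul (by positivity),
    ENNReal.ofReal_rpow_of_nonneg (by positivity) (by norm_num),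
    ← ENNReal.ofReal_mul (by positivity), ENNReal.ofReal_le_ofReal_iff (by positivity),
    ← Real.sqrt_eq_rpow] at hfin
  refine hfin.trans (le_of_eq ?_)
  rw [show ∀ s t : ℝ, 2 * (2 * A2) * s * t = 2 ^ 2 * (A2 * (s * t)) by intros; ring,
    Real.sqrt_mul (by positivity), Real.sqrt_sq (by norm_num), Real.sqrt_mul hA2]
  ring

end TwoWeight
end
end

section
/- Let σ, w be locally finite positive Borel measures on ℝ, let 𝓗 > 0, and suppose C₀ is a constant such that for every interval I₀ ∈ 𝒟 and every partition 𝒫 of I₀ into intervals of 𝒟 there holds Σ_{I∈𝒫} P(1_{I₀}σ, I)²·E(w,I)²·w(I) ≤ C₀·𝓗²·σ(I₀). For I₀ ∈ 𝒟, let 𝓕_energy(I₀) be the collection of maximal intervals I ∈ 𝒟 with I ⊊ I₀ and P(1_{I₀}σ, I)²·E(w,I)²·w(I) > 10·C₀·𝓗²·σ(I). Then Σ_{F ∈ 𝓕_energy(I₀)} σ(F) ≤ σ(I₀)/10. -/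
open MeasureTheory Set Metric Filter
open scoped ENNReal NNReal

noncomputable section

namespace TwoWeight

/-- The interval `I ⊊ I₀` is an energy-stopping interval:
`P(1_{I₀}σ, I)² E(w,I)² w(I) > 10 C₀ 𝓗² σ(I)`. -/
def EnergyBad (σ w : Measure ℝ) (C₀ H : ℝ) (I₀ I : ℤ × ℤ) : Prop :=
  dset I ⊆ dset I₀ ∧ dset I ≠ dset I₀ ∧
    ENNReal.ofReal (10 * C₀ * H ^ 2) * σ (dset I) <
      Pois (σ.restrict (dset I₀)) (dset I) (dlen I) ^ 2 * energySq w I * w (dset I)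

/-- `𝓕_energy(I₀)`: the maximal energy-stopping subintervals of `I₀`. -/
def FenergyColl (σ w : Measure ℝ) (C₀ H : ℝ) (I₀ : ℤ × ℤ) : Set (ℤ × ℤ) :=
  {I | EnergyBad σ w C₀ H I₀ I ∧
    ∀ I', EnergyBad σ w C₀ H I₀ I' → dset I ⊆ dset I' → I' = I}

/-- Membership in a dyadic interval is a condition on the rescaled floor. -/
lemma mem_dset_iff_floor (I : ℤ × ℤ) (x : ℝ) :
    x ∈ dset I ↔ ⌊x / (2 : ℝ) ^ I.1⌋ = I.2 := by
  have h : (0 : ℝ) < 2 ^ I.1 := by positivity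
  rw [Int.floor_eq_iff, le_div_iff₀ h, div_lt_iff₀ h, dset, mem_Ico, dleft, dright,
    mul_comm (I.2 : ℝ), mul_comm ((I.2 : ℝ) + 1)]

/-- A dyadic interval that meets one of at least its own scale is contained in it. -/
lemma dset_subset_or_disjoint {I J : ℤ × ℤ} (h : I.1 ≤ J.1) :
    dset I ⊆ dset J ∨ Disjoint (dset I) (dset J) := by
  obtain ⟨n, hn⟩ := Int.le.dest h
  have floor_eq (x : ℝ) :
      ⌊x / (2 : ℝ) ^ J.1⌋ = ⌊x / (2 : ℝ) ^ I.1⌋ / ((2 ^ n : ℕ) : ℤ) := by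
    rw [← Int.floor_div_natCast, ← hn, zpow_add₀ two_ne_zero, div_div]
    push_cast
    rw [zpow_natCast]
  rw [or_iff_not_imp_right, not_disjoint_iff]
  rintro ⟨z, hzI, hzJ⟩ y hy
  rw [mem_dset_iff_floor] at *
  rw [floor_eq, hy, ← hzI, ← floor_eq, hzJ]

/-- A finite disjoint family of dyadic subintervals of `I₀` extends to a dyadic partition
of `I₀`. -/
lemma exists_dyadic_partition (I₀ : ℤ × ℤ) (s : Finset (ℤ × ℤ))
    (hsub : ∀ I ∈ s, dset I ⊆ dset I₀) (hdisj : (s : Set (ℤ × ℤ)).PairwiseDisjoint dset) :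
    ∃ P : Set (ℤ × ℤ), (s : Set (ℤ × ℤ)) ⊆ P ∧ (∀ I ∈ P, dset I ⊆ dset I₀) ∧
      P.PairwiseDisjoint dset ∧ (⋃ I ∈ P, dset I) = dset I₀ := by
  classical
  obtain ⟨k, hk⟩ := ((insert I₀ s).image Prod.fst).bddBelow
  have hk' : ∀ I ∈ insert I₀ s, k ≤ I.1 := fun I hI =>
    hk (Finset.mem_coe.2 (Finset.mem_image_of_mem _ hI))
  let R : Set (ℤ × ℤ) :=
    {J | J.1 = k ∧ dset J ⊆ dset I₀ ∧ ∀ I ∈ s, Disjoint (dset J) (dset I)}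
  have hP : ∀ I ∈ (s : Set (ℤ × ℤ)) ∪ R, dset I ⊆ dset I₀ := by
    rintro I (hI | hI)
    exacts [hsub I hI, hI.2.1]
  refine ⟨s ∪ R, subset_union_left, hP, ?_, ?_⟩
  · rintro I (hI | hI) J (hJ | hJ) hne
    · exact hdisj hI hJ hne
    · exact (hJ.2.2 I hI).symm
    · exact hI.2.2 J hJ
    · refine disjoint_left.2 fun x hxI hxJ => hne ?_
      rw [mem_dset_iff_floor, hI.1] at hxI
      rw [mem_dset_iff_floor, hJ.1] at hxJ
      exact Prod.ext (hI.1.trans hJ.1.symm) (hxI.symm.trans hxJ)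
  · refine (iUnion₂_subset hP).antisymm fun x hx => ?_
    rw [mem_iUnion₂]
    by_cases h : ∃ I ∈ s, x ∈ dset I
    · obtain ⟨I, hI, hxI⟩ := h
      exact ⟨I, Or.inl hI, hxI⟩
    · push Not at h
      have hxJ : x ∈ dset (k, ⌊x / (2 : ℝ) ^ k⌋) := by rw [mem_dset_iff_floor]
      refine ⟨_, Or.inr ⟨rfl, ?_, fun I hI => ?_⟩, hxJ⟩
      · exact (dset_subset_or_disjoint (hk' I₀ (by simp))).resolve_right
          (not_disjoint_iff.2 ⟨x, hxJ, hx⟩)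
      · exact (dset_subset_or_disjoint (hk' I (by simp [hI]))).resolve_left
          fun hs => h I hI (hs hxJ)

/-- Maximal energy-stopping intervals are pairwise disjoint. -/
lemma pairwiseDisjoint_FenergyColl (σ w : Measure ℝ) (C₀ H : ℝ) (I₀ : ℤ × ℤ) :
    (FenergyColl σ w C₀ H I₀).PairwiseDisjoint dset := by
  intro I hI J hJ hne
  rcases le_total I.1 J.1 with h | h
  · exact (dset_subset_or_disjoint h).resolve_left fun hs => hne (hI.2 J hJ.1 hs).symm
  · exact ((dset_subset_or_disjoint h).resolve_left fun hs => hne (hJ.2 I hI.1 hs)).symm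

/-- Definition 3.3.  If the energy inequality holds with constant
`C₀ 𝓗²`, then the maximal energy-stopping intervals of `I₀` carry at most a tenth of
the `σ`-mass of `I₀`. -/
theorem statement7 (σ w : Measure ℝ) (C₀ H : ℝ)
    (hσ : IsLocallyFiniteMeasure σ) (hw : IsLocallyFiniteMeasure w)
    (hH : 0 < H) (hC₀ : 0 ≤ C₀)
    (henergy : ∀ (I₀ : ℤ × ℤ) (Pcoll : Set (ℤ × ℤ)),
      (∀ I ∈ Pcoll, dset I ⊆ dset I₀) →
      Pcoll.PairwiseDisjoint dset →
      (⋃ I ∈ Pcoll, dset I) = dset I₀ →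
      (∑' I : Pcoll, Pois (σ.restrict (dset I₀)) (dset I.1) (dlen I.1) ^ 2 *
          energySq w I.1 * w (dset I.1))
        ≤ ENNReal.ofReal (C₀ * H ^ 2) * σ (dset I₀)) :
    ∀ I₀ : ℤ × ℤ,
      (∑' F : FenergyColl σ w C₀ H I₀, σ (dset F.1)) ≤ σ (dset I₀) / 10 := by
  classical
  intro I₀
  rw [ENNReal.tsum_eq_iSup_sum]
  refine iSup_le fun t => ?_
  let s : Finset (ℤ × ℤ) := t.map (Function.Embedding.subtype _)
  have hs : ∀ I ∈ s, I ∈ FenergyColl σ w C₀ H I₀ := fun I hI =>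
    Finset.property_of_mem_map_subtype t hI
  have hsum : ∑ F ∈ t, σ (dset F.1) = ∑ I ∈ s, σ (dset I) := by simp [s]
  rw [hsum]
  obtain ⟨P, hsP, hPsub, hPdisj, hPunion⟩ := exists_dyadic_partition I₀ s
    (fun I hI => (hs I hI).1.1) ((pairwiseDisjoint_FenergyColl σ w C₀ H I₀).subset hs)
  let f : ℤ × ℤ → ℝ≥0∞ := fun I =>
    Pois (σ.restrict (dset I₀)) (dset I) (dlen I) ^ 2 * energySq w I * w (dset I)
  have hle : ∑ I ∈ s, f I ≤ ENNReal.ofReal (C₀ * H ^ 2) * σ (dset I₀) :=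
    calc ∑ I ∈ s, f I = ∑ I ∈ s, P.indicator f I :=
          Finset.sum_congr rfl fun I hI => (indicator_of_mem (hsP hI) f).symm
      _ ≤ ∑' I, P.indicator f I := ENNReal.sum_le_tsum s
      _ = ∑' I : P, f I := (tsum_subtype P f).symm
      _ ≤ _ := henergy I₀ P hPsub hPdisj hPunion
  have hbad : ∀ I ∈ s, ENNReal.ofReal (C₀ * H ^ 2) * 10 * σ (dset I) < f I := by
    intro I hI
    have h := (hs I hI).1.2.2
    rwa [show 10 * C₀ * H ^ 2 = C₀ * H ^ 2 * 10 by ring, ENNReal.ofReal_mul (by positivity),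
      ENNReal.ofReal_ofNat] at h
  rcases eq_or_ne (ENNReal.ofReal (C₀ * H ^ 2)) 0 with h0 | h0
  · rw [h0, zero_mul, nonpos_iff_eq_zero, Finset.sum_eq_zero_iff] at hle
    have hempty : s = ∅ := Finset.eq_empty_of_forall_notMem fun I hI =>
      not_lt_zero ((hbad I hI).trans_eq (hle I hI))
    simp [hempty]
  · have h := (Finset.sum_le_sum fun I hI => (hbad I hI).le).trans hle
    rw [← Finset.mul_sum, mul_assoc, ENNReal.mul_le_mul_iff_right h0 ENNReal.ofReal_ne_top] at h
    rwa [ENNReal.le_div_iff_mul_le (by simp) (by simp), mul_comm]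

end TwoWeight
end
end

section
/- Let σ be a locally finite positive Borel measure on ℝ, I₀ ∈ 𝒟, and f ∈ L¹(I₀,σ). Let 𝓕 ⊂ 𝒟 be a collection of subintervals of I₀ with I₀ ∈ 𝓕 such that for every F ∈ 𝓕, the 𝓕-children of F (the maximal F′ ∈ 𝓕 with F′ ⊊ F) split into two families 𝓔(F) and 𝓐(F) where Σ_{F′∈𝓔(F)} σ(F′) ≤ σ(F)/10 and every F′ ∈ 𝓐(F) satisfies E^σ_{F′}|f| ≥ 5·E^σ_F|f| > 0. Then 𝓕 is σ-Carleson with constant 2: Σ_{F∈𝓕, F⊂S} σ(F) ≤ 2σ(S) for every S ∈ 𝒟. -/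
open MeasureTheory Set Metric Filter
open scoped ENNReal NNReal

noncomputable section

namespace TwoWeight

/-- `F'` is an `𝓕`-child of `F`: a maximal member of `𝓕` strictly contained in `F`. -/
def IsFChild (Fc : Set (ℤ × ℤ)) (F F' : ℤ × ℤ) : Prop :=
  F' ∈ Fc ∧ dset F' ⊆ dset F ∧ dset F' ≠ dset F ∧
    ∀ F'' ∈ Fc, dset F' ⊆ dset F'' → dset F'' ⊆ dset F → F'' = F' ∨ F'' = F

lemma dleft_mem_dset (I : ℤ × ℤ) : dleft I ∈ dset I := by
  have : (0 : ℝ) < 2 ^ I.1 := by positivity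
  refine ⟨le_rfl, ?_⟩
  unfold dleft dright
  nlinarith

lemma dset_subset_of_mem {a b : ℤ × ℤ} (h : a.1 ≤ b.1) {x : ℝ} (ha : x ∈ dset a)
    (hb : x ∈ dset b) : dset a ⊆ dset b := by
  obtain ⟨k, m⟩ := a
  obtain ⟨l, p⟩ := b
  obtain ⟨n, rfl⟩ := Int.le.dest h
  have hk : (0 : ℝ) < 2 ^ k := by positivity
  have hpow : (2 : ℝ) ^ (k + (n : ℤ)) = 2 ^ k * 2 ^ n := by
    rw [zpow_add₀ two_ne_zero, zpow_natCast]
  simp only [dset, dleft, dright, mem_Ico, hpow, mul_assoc] at ha hb ⊢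
  have h1 : (m : ℝ) < 2 ^ n * (p + 1) := lt_of_mul_lt_mul_left (ha.1.trans_lt hb.2) hk.le
  have h2 : (2 : ℝ) ^ n * p < m + 1 := lt_of_mul_lt_mul_left (hb.1.trans_lt ha.2) hk.le
  have h1' : m + 1 ≤ 2 ^ n * (p + 1) := by
    have : m < 2 ^ n * (p + 1) := by exact_mod_cast h1
    omega
  have h2' : 2 ^ n * p ≤ m := by
    have : 2 ^ n * p < m + 1 := by exact_mod_cast h2
    omega
  apply Ico_subset_Ico
  · exact mul_le_mul_of_nonneg_left (by exact_mod_cast h2') hk.le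
  · exact mul_le_mul_of_nonneg_left (by exact_mod_cast h1') hk.le

lemma scale_le_of_dset_subset {a b : ℤ × ℤ} (h : dset a ⊆ dset b) : a.1 ≤ b.1 := by
  have ha : dleft a < dright a := (dleft_mem_dset a).2
  obtain ⟨h1, h2⟩ := (Ico_subset_Ico_iff ha).1 h
  have hlen : (2 : ℝ) ^ a.1 ≤ 2 ^ b.1 := by
    unfold dleft dright at *
    linarith
  exact (zpow_le_zpow_iff_right₀ one_lt_two).1 hlen

lemma eq_of_dset_subset {a b : ℤ × ℤ} (h : dset a ⊆ dset b) (hs : a.1 = b.1) : a = b := by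
  have ha : dleft a < dright a := (dleft_mem_dset a).2
  obtain ⟨h1, h2⟩ := (Ico_subset_Ico_iff ha).1 h
  obtain ⟨k, m⟩ := a
  obtain ⟨l, p⟩ := b
  obtain rfl : k = l := hs
  have hk : (0 : ℝ) < 2 ^ k := by positivity
  simp only [dleft, dright] at h1 h2
  have h1' : p ≤ m := by exact_mod_cast le_of_mul_le_mul_left h1 hk
  have h2' : (m : ℝ) + 1 ≤ p + 1 := le_of_mul_le_mul_left h2 hk
  have h2'' : m + 1 ≤ p + 1 := by exact_mod_cast h2'
  rw [Prod.mk.injEq]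
  omega

lemma dset_injective : Function.Injective dset := fun _ _ h =>
  eq_of_dset_subset h.subset
    (le_antisymm (scale_le_of_dset_subset h.subset) (scale_le_of_dset_subset h.superset))

lemma measurableSet_dset (I : ℤ × ℤ) : MeasurableSet (dset I) := measurableSet_Ico

/-- The members of `Q` whose dyadic interval is maximal for inclusion. -/
def maxSet (Q : Set (ℤ × ℤ)) : Set (ℤ × ℤ) :=
  {M ∈ Q | ∀ M' ∈ Q, dset M ⊆ dset M' → M' = M}

lemma exists_mem_maxSet {Q : Set (ℤ × ℤ)} {S G : ℤ × ℤ} (hQ : ∀ M ∈ Q, dset M ⊆ dset S)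
    (hG : G ∈ Q) : ∃ M ∈ maxSet Q, dset G ⊆ dset M := by
  obtain ⟨k, ⟨M, hM, hGM, rfl⟩, hk⟩ := Int.exists_greatest_of_bdd
    (P := fun k => ∃ M ∈ Q, dset G ⊆ dset M ∧ M.1 = k)
    ⟨S.1, by rintro _ ⟨M, hM, -, rfl⟩; exact scale_le_of_dset_subset (hQ M hM)⟩
    ⟨G.1, G, hG, Subset.rfl, rfl⟩
  refine ⟨M, ⟨hM, fun M' hM' h => ?_⟩, hGM⟩
  exact (eq_of_dset_subset h (le_antisymm (scale_le_of_dset_subset h)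
    (hk _ ⟨M', hM', hGM.trans h, rfl⟩))).symm

lemma pairwiseDisjoint_maxSet (Q : Set (ℤ × ℤ)) : (maxSet Q).PairwiseDisjoint dset := by
  intro a ha b hb hab
  by_contra h
  obtain ⟨x, hxa, hxb⟩ := not_disjoint_iff.1 h
  rcases le_total a.1 b.1 with hle | hle
  · exact hab (ha.2 b hb.1 (dset_subset_of_mem hle hxa hxb)).symm
  · exact hab (hb.2 a ha.1 (dset_subset_of_mem hle hxb hxa))

lemma setOf_isFChild (Fc : Set (ℤ × ℤ)) (F : ℤ × ℤ) :
    {F' | IsFChild Fc F F'} = maxSet {G ∈ Fc | dset G ⊆ dset F ∧ G ≠ F} := by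
  ext G
  constructor
  · rintro ⟨h1, h2, h3, h4⟩
    refine ⟨⟨h1, h2, fun h => h3 (h ▸ rfl)⟩, fun M hM hGM => ?_⟩
    exact (h4 M hM.1 hGM hM.2.1).resolve_right hM.2.2
  · rintro ⟨⟨h1, h2, h3⟩, h4⟩
    refine ⟨h1, h2, fun h => h3 (dset_injective h), fun M hM hGM hMF => ?_⟩
    by_cases h : M = F
    · exact Or.inr h
    · exact Or.inl (h4 M ⟨hM, hMF, h⟩ hGM)

/-- Total measure of the members of `Q` of scale at least `m` that lie inside `S`. -/
def packing (σ : Measure ℝ) (Q : Set (ℤ × ℤ)) (m : ℤ) (S : ℤ × ℤ) : ℝ≥0∞ :=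
  ∑' G, {G ∈ Q | dset G ⊆ dset S ∧ m ≤ G.1}.indicator (fun G => σ (dset G)) G

lemma packing_mono (σ : Measure ℝ) {Q Q' : Set (ℤ × ℤ)} {S : ℤ × ℤ}
    (h : ∀ G ∈ Q, dset G ⊆ dset S → G ∈ Q') (m : ℤ) :
    packing σ Q m S ≤ packing σ Q' m S := by
  refine ENNReal.tsum_le_tsum fun G => ?_
  refine indicator_le_indicator_of_subset (fun M hM => ?_) (fun _ => zero_le) G
  exact ⟨h M hM.1 hM.2.1, hM.2⟩

lemma packing_le_tsum_maxSet (σ : Measure ℝ) {Q : Set (ℤ × ℤ)} (m : ℤ) {S : ℤ × ℤ}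
    (hQ : ∀ M ∈ Q, dset M ⊆ dset S) :
    packing σ Q m S ≤ ∑' M : maxSet Q, packing σ Q m M := by
  unfold packing
  rw [ENNReal.tsum_comm]
  refine ENNReal.tsum_le_tsum fun G => ?_
  refine indicator_apply_le' (fun hG => ?_) (fun _ => zero_le)
  obtain ⟨M, hM, hGM⟩ := exists_mem_maxSet hQ hG.1
  refine le_trans ?_ (ENNReal.le_tsum ⟨M, hM⟩)
  rw [indicator_of_mem (show G ∈ {G ∈ Q | dset G ⊆ dset M ∧ m ≤ G.1} from ⟨hG.1, hGM, hG.2.2⟩)]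

lemma packing_le_add (σ : Measure ℝ) (Q : Set (ℤ × ℤ)) (m : ℤ) (F : ℤ × ℤ) :
    packing σ Q m F ≤ σ (dset F) + packing σ {G ∈ Q | dset G ⊆ dset F ∧ G ≠ F} m F := by
  classical
  unfold packing
  rw [← tsum_ite_eq F (fun G => σ (dset G)), ← ENNReal.tsum_add]
  refine ENNReal.tsum_le_tsum fun G => ?_
  refine indicator_apply_le' (fun hG => ?_) (fun _ => zero_le)
  by_cases h : G = F
  · simp [h]
  · rw [indicator_of_mem]
    · exact le_add_self
    · exact ⟨⟨hG.1, hG.2.1, h⟩, hG.2⟩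

lemma tsum_dset_le (σ : Measure ℝ) {T : Set (ℤ × ℤ)} (hT : T.PairwiseDisjoint dset)
    {S : ℤ × ℤ} (hS : ∀ M ∈ T, dset M ⊆ dset S) :
    ∑' M : T, σ (dset M) ≤ σ (dset S) := by
  rw [← measure_biUnion T.to_countable hT fun M _ => measurableSet_dset M]
  exact measure_mono (iUnion₂_subset hS)

lemma packing_le_of_children (σ : Measure ℝ) (Fc : Set (ℤ × ℤ))
    (h : ∀ F ∈ Fc, 2 * ∑' F' : {F' | IsFChild Fc F F'}, σ (dset F') ≤ σ (dset F))
    (m : ℤ) (n : ℕ) : ∀ F ∈ Fc, F.1 < m + n → packing σ Fc m F ≤ 2 * σ (dset F) := by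
  induction n with
  | zero =>
    intro F _ hFm
    refine le_of_eq_of_le (ENNReal.tsum_eq_zero.2 fun G => indicator_of_notMem ?_ _) zero_le
    rintro ⟨-, hG, hm⟩
    have := scale_le_of_dset_subset hG
    simp at hFm
    omega
  | succ n ih =>
    intro F hF hFm
    have hchild := h F hF
    rw [setOf_isFChild Fc F] at hchild
    set Q := {G ∈ Fc | dset G ⊆ dset F ∧ G ≠ F} with hQ
    have hlt : ∀ M ∈ Q, M.1 < F.1 := fun M hM =>
      (scale_le_of_dset_subset hM.2.1).lt_of_ne fun he => hM.2.2 (eq_of_dset_subset hM.2.1 he)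
    calc packing σ Fc m F ≤ σ (dset F) + packing σ Q m F := packing_le_add σ Fc m F
      _ ≤ σ (dset F) + ∑' M : maxSet Q, packing σ Q m M := by
          gcongr
          exact packing_le_tsum_maxSet σ m fun M hM => hM.2.1
      _ ≤ σ (dset F) + ∑' M : maxSet Q, 2 * σ (dset M) := by
          gcongr with M
          refine (packing_mono σ (fun G hG _ => hG.1) m).trans (ih M M.2.1.1 ?_)
          have := hlt M M.2.1
          push_cast at hFm
          omega
      _ ≤ 2 * σ (dset F) := by
          rw [ENNReal.tsum_mul_left, two_mul (σ (dset F))]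
          gcongr

lemma carleson_of_children (σ : Measure ℝ) (Fc : Set (ℤ × ℤ))
    (h : ∀ F ∈ Fc, 2 * ∑' F' : {F' | IsFChild Fc F F'}, σ (dset F') ≤ σ (dset F)) :
    Carleson σ Fc := by
  intro S
  have key (m : ℤ) : packing σ Fc m S ≤ 2 * σ (dset S) := by
    set Q := {G ∈ Fc | dset G ⊆ dset S}
    calc packing σ Fc m S ≤ packing σ Q m S :=
          packing_mono σ (Q' := Q) (fun G hG hGS => ⟨hG, hGS⟩) m
      _ ≤ ∑' M : maxSet Q, packing σ Q m M := packing_le_tsum_maxSet σ m fun M hM => hM.2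
      _ ≤ ∑' M : maxSet Q, 2 * σ (dset M) := by
          gcongr with M
          exact (packing_mono σ (fun G hG _ => hG.1) m).trans
            (packing_le_of_children σ Fc h m (M.1.1 - m + 1).toNat M M.2.1.1 (by omega))
      _ ≤ 2 * σ (dset S) := by
          rw [ENNReal.tsum_mul_left]
          gcongr
          exact tsum_dset_le σ (pairwiseDisjoint_maxSet Q) fun M hM => hM.1.2
  refine ENNReal.summable.tsum_le_of_sum_le fun T => ?_
  obtain ⟨m, hm⟩ := (T.image fun G => G.1.1).bddBelow
  refine le_trans ?_ (key m)
  calc ∑ G ∈ T, σ (dset G.1)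
      = ∑ G ∈ T.map (Function.Embedding.subtype _),
          {G ∈ Fc | dset G ⊆ dset S ∧ m ≤ G.1}.indicator (fun G => σ (dset G)) G := by
        rw [Finset.sum_map]
        refine Finset.sum_congr rfl fun G hG => ?_
        rw [indicator_of_mem]
        · rfl
        · exact ⟨G.2.1, G.2.2, hm (Finset.mem_coe.2 (Finset.mem_image_of_mem _ hG))⟩
    _ ≤ packing σ Fc m S := ENNReal.sum_le_tsum _

lemma five_mul_tsum_le_of_avg (σ : Measure ℝ) [IsLocallyFiniteMeasure σ] {F : ℤ × ℤ}
    {f : ℝ → ℝ} (hf : IntegrableOn f (dset F) σ) {A : Set (ℤ × ℤ)}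
    (hdisj : A.PairwiseDisjoint dset) (hsub : ∀ G ∈ A, dset G ⊆ dset F)
    (hA : ∀ G ∈ A, 0 < avg σ (dset F) (fun x => |f x|) ∧
      5 * avg σ (dset F) (fun x => |f x|) ≤ avg σ (dset G) (fun x => |f x|)) :
    5 * ∑' G : A, σ (dset G) ≤ σ (dset F) := by
  rcases A.eq_empty_or_nonempty with rfl | ⟨G₀, hG₀⟩
  · simp
  have hc := (hA G₀ hG₀).1
  set c := avg σ (dset F) (fun x => |f x|) with hcdef
  have hfin (G : ℤ × ℤ) : σ (dset G) ≠ ⊤ := measure_Ico_lt_top.ne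
  have hint {G : ℤ × ℤ} (hG : dset G ⊆ dset F) :
      ENNReal.ofReal (∫ x in dset G, |f x| ∂σ) = ∫⁻ x in dset G, ‖f x‖ₑ ∂σ :=
    ofReal_integral_norm_eq_lintegral_enorm (hf.mono_set hG)
  have hone (G : A) : ENNReal.ofReal c * (5 * σ (dset G)) ≤ ∫⁻ x in dset G, ‖f x‖ₑ ∂σ := by
    rw [← hint (hsub G G.2)]
    have h5 := (hA G G.2).2
    have hpos : 0 < (σ (dset G)).toReal := by
      refine ENNReal.toReal_nonneg.lt_of_ne fun h0 => ?_
      rw [avg, ← h0, div_zero] at h5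
      linarith
    rw [avg, le_div_iff₀ hpos] at h5
    rw [← ENNReal.ofReal_toReal (hfin G), ← ENNReal.ofReal_ofNat,
      ← ENNReal.ofReal_mul (by norm_num), ← ENNReal.ofReal_mul hc.le]
    exact ENNReal.ofReal_le_ofReal (by linarith)
  have htot : ∫⁻ x in dset F, ‖f x‖ₑ ∂σ = ENNReal.ofReal c * σ (dset F) := by
    have hne : (σ (dset F)).toReal ≠ 0 := by
      intro h0
      rw [hcdef, avg, h0, div_zero] at hc
      exact hc.false
    rw [← hint Subset.rfl, ← ENNReal.ofReal_toReal (hfin F), ← ENNReal.ofReal_mul hc.le,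
      hcdef, avg, div_mul_cancel₀ _ hne]
  refine (ENNReal.mul_le_mul_iff_right (a := ENNReal.ofReal c) (by simpa using hc)
    ENNReal.ofReal_ne_top).1 ?_
  rw [← ENNReal.tsum_mul_left, ← ENNReal.tsum_mul_left, ← htot]
  calc ∑' G : A, ENNReal.ofReal c * (5 * σ (dset G))
      ≤ ∑' G : A, ∫⁻ x in dset G, ‖f x‖ₑ ∂σ := ENNReal.tsum_le_tsum hone
    _ = ∫⁻ x in ⋃ G ∈ A, dset G, ‖f x‖ₑ ∂σ :=
        (lintegral_biUnion A.to_countable (fun G _ => measurableSet_dset G) hdisj _).symm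
    _ ≤ ∫⁻ x in dset F, ‖f x‖ₑ ∂σ := lintegral_mono_set (iUnion₂_subset hsub)

/-- Lemma 3.7, the `σ`-Carleson property of the stopping tree.
If at each `F ∈ 𝓕` the `𝓕`-children split into a family `E` of small total `σ`-measure
and a family `A` of intervals where the average of `|f|` jumps by a factor `5`, then
`𝓕` is `σ`-Carleson with constant `2`. -/
theorem statement8 (σ : Measure ℝ) (I₀ : ℤ × ℤ) (f : ℝ → ℝ) (Fc : Set (ℤ × ℤ))
    (hσ : IsLocallyFiniteMeasure σ)
    (hf : IntegrableOn f (dset I₀) σ)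
    (hsub : ∀ F ∈ Fc, dset F ⊆ dset I₀) (htop : I₀ ∈ Fc)
    (hsplit : ∀ F ∈ Fc, ∃ E A : Set (ℤ × ℤ),
      Disjoint E A ∧
      (∀ F' : ℤ × ℤ, IsFChild Fc F F' ↔ (F' ∈ E ∨ F' ∈ A)) ∧
      (∑' F' : E, σ (dset F'.1)) ≤ σ (dset F) / 10 ∧
      (∀ F' ∈ A, 0 < avg σ (dset F) (fun x => |f x|) ∧
        5 * avg σ (dset F) (fun x => |f x|) ≤ avg σ (dset F') (fun x => |f x|))) :
    Carleson σ Fc := by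
  refine carleson_of_children σ Fc fun F hF => ?_
  obtain ⟨E, A, -, hEA, hE, hA⟩ := hsplit F hF
  have hunion : {F' | IsFChild Fc F F'} = E ∪ A := ext hEA
  have hAc : A ⊆ {F' | IsFChild Fc F F'} := hunion ▸ subset_union_right
  have hA' := five_mul_tsum_le_of_avg σ (hf.mono_set (hsub F hF))
    ((setOf_isFChild Fc F ▸ pairwiseDisjoint_maxSet _ :
      {F' | IsFChild Fc F F'}.PairwiseDisjoint dset).subset hAc)
    (fun G hG => (hAc hG).2.1) hA
  have hE' : 10 * ∑' G : E, σ (dset G) ≤ σ (dset F) := by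
    rw [mul_comm]
    exact ENNReal.mul_le_of_le_div hE
  rw [hunion]
  have hle := ENNReal.tsum_union_le (fun G => σ (dset G)) E A
  refine (ENNReal.mul_le_mul_iff_right (a := 10) (by norm_num) (by norm_num)).1 ?_
  calc (10 : ℝ≥0∞) * (2 * ∑' G : ↥(E ∪ A), σ (dset G))
      ≤ 10 * (2 * (∑' G : E, σ (dset G) + ∑' G : A, σ (dset G))) := by gcongr
    _ = 2 * (10 * ∑' G : E, σ (dset G)) + 4 * (5 * ∑' G : A, σ (dset G)) := by ring
    _ ≤ 2 * σ (dset F) + 4 * σ (dset F) := by gcongr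
    _ = 6 * σ (dset F) := by ring
    _ ≤ 10 * σ (dset F) := by gcongr; norm_num

end TwoWeight
end
end

section
/- Let σ be a locally finite positive Borel measure on ℝ and fix 0 < ε < 1/2. Let J ⊂ I ⊂ I₀ be intervals with dist(J, I₀∖I) ≥ |J|^ε·|I|^{1−ε} (this holds in particular when J, I ∈ 𝒟, J is (ε,r)-good and 2^r|J| ≤ |I|). Then |J|^{2ε−1}·P(1_{I₀∖I}σ, J) ≤ C·|I|^{2ε−1}·P(1_{I₀∖I}σ, I) with an absolute constant C. -/
open MeasureTheory Set Metric Filter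
open scoped ENNReal NNReal

noncomputable section

namespace TwoWeight

/-- Pointwise comparison of the weighted Poisson kernels of lengths `j ≤ l`, at a point whose
distance `D` to the shorter interval is at least `j ^ ε * l ^ (1 - ε)`. -/
lemma poisson_kernel_le {ε j l t D : ℝ} (hε : 0 ≤ ε) (hj : 0 < j) (hjl : j ≤ l)
    (ht : 0 ≤ t) (htD : t ≤ D) (hD : j ^ ε * l ^ (1 - ε) ≤ D) :
    j ^ (2 * ε - 1) * (j / (j ^ 2 + D ^ 2)) ≤
      2 * l ^ (2 * ε - 1) * (l / (l ^ 2 + t ^ 2)) := by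
  have hl : 0 < l := hj.trans_le hjl
  have rpow_split {y : ℝ} (hy : 0 < y) : y ^ (2 * ε - 1) * y = (y ^ ε) ^ 2 := by
    rw [Real.rpow_sub_one hy.ne', div_mul_cancel₀ _ hy.ne', mul_comm, Real.rpow_mul hy.le,
      Real.rpow_two]
  have hl_split : l ^ ε * l ^ (1 - ε) = l := by
    rw [← Real.rpow_add hl, add_sub_cancel, Real.rpow_one]
  have hpow : j ^ ε ≤ l ^ ε := Real.rpow_le_rpow hj.le hjl hε
  have hjε : 0 < j ^ ε := Real.rpow_pos_of_pos hj ε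
  have hlε : 0 < l ^ ε := Real.rpow_pos_of_pos hl ε
  have near : j ^ ε * l ≤ l ^ ε * D := by
    calc j ^ ε * l = l ^ ε * (j ^ ε * l ^ (1 - ε)) := by
          nth_rewrite 1 [← hl_split]
          ring
      _ ≤ l ^ ε * D := by gcongr
  have far : j ^ ε * t ≤ l ^ ε * D := by gcongr
  have near_sq : (j ^ ε * l) ^ 2 ≤ (l ^ ε * D) ^ 2 := by gcongr
  have far_sq : (j ^ ε * t) ^ 2 ≤ (l ^ ε * D) ^ 2 := by gcongr
  rw [← mul_div_assoc, rpow_split hj, ← mul_div_assoc, mul_assoc, rpow_split hl,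
    div_le_div_iff₀ (by positivity) (by positivity)]
  nlinarith [sq_nonneg (l ^ ε * j)]

/-- Lemma 4.4, the Poisson inequality \eqref{e.Jsimeq}.
For nested intervals `J = (a,b) ⊆ I = (c,d) ⊆ I₀ = (e,e')` with
`dist(J, I₀∖I) ≥ |J|^ε |I|^(1-ε)`, one has
`|J|^{2ε-1} P(1_{I₀∖I}σ, J) ≤ C |I|^{2ε-1} P(1_{I₀∖I}σ, I)`. -/
theorem statement10 :
    ∃ C : ℝ, 0 < C ∧
      ∀ (σ : Measure ℝ) (ε a b c d e e' : ℝ),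
        IsLocallyFiniteMeasure σ →
        0 < ε → ε < 1 / 2 →
        a < b → c < d → e < e' →
        Ioo a b ⊆ Ioo c d → Ioo c d ⊆ Ioo e e' →
        (∀ x ∈ Ioo e e' \ Ioo c d,
          (b - a) ^ ε * (d - c) ^ (1 - ε) ≤ infDist x (Ioo a b)) →
        ENNReal.ofReal ((b - a) ^ (2 * ε - 1)) *
            Pois (σ.restrict (Ioo e e' \ Ioo c d)) (Ioo a b) (b - a)
          ≤ ENNReal.ofReal (C * (d - c) ^ (2 * ε - 1)) *
              Pois (σ.restrict (Ioo e e' \ Ioo c d)) (Ioo c d) (d - c) := by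
  refine ⟨2, two_pos, ?_⟩
  intro σ ε a b c d e e' _ hε _ hab hcd _ hJI _ hdist
  obtain ⟨hca, hbd⟩ := (Ioo_subset_Ioo_iff hab).1 hJI
  unfold Pois
  rw [← lintegral_const_mul' _ _ ENNReal.ofReal_ne_top,
    ← lintegral_const_mul' _ _ ENNReal.ofReal_ne_top]
  refine setLIntegral_mono' (measurableSet_Ioo.diff measurableSet_Ioo) fun x hx => ?_
  rw [← ENNReal.ofReal_mul (Real.rpow_nonneg (sub_pos.2 hab).le _),
    ← ENNReal.ofReal_mul (mul_nonneg zero_le_two (Real.rpow_nonneg (sub_pos.2 hcd).le _))]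
  exact ENNReal.ofReal_le_ofReal <| poisson_kernel_le hε.le (sub_pos.2 hab)
    (sub_le_sub hbd hca) infDist_nonneg
    (infDist_le_infDist_of_subset hJI (nonempty_Ioo.2 hab)) (hdist x hx)

end TwoWeight
end
end
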